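/- arXiv:2204.04171 — 7 statements merged into one kernel-verified Lean document; each statement's English description precedes it below -/
import Mathlib

section
/- Let n ≥ 3 and let Π ⊂ ℝⁿ be an (n−1)-dimensional simplex. Then for every sufficiently small δ > 0 there exist a set Δ = Δ(δ) ⊂ ℝⁿ, which is an n-dimensional simplex with base Π, and a piecewise affine homeomorphism Φ_δ : ℝⁿ ∖ Π → ℝⁿ ∖ Δ such that: (i) ℝⁿ ∖ Δ is a Lipschitz domain; (ii) Φ_δ(x) = x for every x ∈ ℝⁿ ∖ (Π)_δ; (iii) sup_{x ∈ ℝⁿ∖Π} |Φ_δ(x) − x| + ess sup |DΦ_δ − I| tends to 0 as δ → 0. -/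
open Filter MeasureTheory Set
open scoped ENNReal

noncomputable section

/-- `v` is piecewise affine on `U`: continuous on `U` and affine on each element of a finite
family of pairwise disjoint open subsets of `U` covering `U` up to a Lebesgue-null set. -/
def PiecewiseAffineOn {E F : Type*} [NormedAddCommGroup E] [NormedSpace ℝ E]
    [MeasureSpace E] [NormedAddCommGroup F] [NormedSpace ℝ F]
    (v : E → F) (U : Set E) : Prop :=
  ContinuousOn v U ∧
  ∃ (N : ℕ) (V : Fin N → Set E),
    (∀ i, IsOpen (V i)) ∧ (∀ i, V i ⊆ U) ∧
    (∀ i j, i ≠ j → Disjoint (V i) (V j)) ∧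
    volume (U \ ⋃ i, V i) = 0 ∧
    ∀ i, ∃ (L : E →L[ℝ] F) (c : F), ∀ x ∈ V i, v x = L x + c

/-- The Clarke subdifferential of `f` at `x`: the convex hull of all limits of derivatives
`fderiv ℝ f xₖ` along sequences `xₖ → x` of points of differentiability. -/
def clarkeSubdiff {E F : Type*} [NormedAddCommGroup E] [NormedSpace ℝ E]
    [NormedAddCommGroup F] [NormedSpace ℝ F] (f : E → F) (x : E) : Set (E →L[ℝ] F) :=
  convexHull ℝ {A | ∃ u : ℕ → E, Tendsto u atTop (nhds x) ∧
    (∀ k, DifferentiableAt ℝ f (u k)) ∧ Tendsto (fun k => fderiv ℝ f (u k)) atTop (nhds A)}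

/-- The matrix of a continuous linear map. -/
def clmMat {n m : ℕ} (A : EuclideanSpace ℝ (Fin n) →L[ℝ] (Fin m → ℝ)) :
    Matrix (Fin m) (Fin n) ℝ :=
  Matrix.of fun i j => A (EuclideanSpace.single j 1) i

/-- The Jacobian matrix of `f` at `x` (junk value where `f` is not differentiable). -/
def jacMat {n m : ℕ} (f : EuclideanSpace ℝ (Fin n) → (Fin m → ℝ)) (x : EuclideanSpace ℝ (Fin n)) :
    Matrix (Fin m) (Fin n) ℝ := clmMat (fderiv ℝ f x)

/-- Frobenius norm of a matrix. -/
noncomputable def mnorm {k l : ℕ} (A : Matrix (Fin k) (Fin l) ℝ) : ℝ :=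
  Real.sqrt (∑ i, ∑ j, A i j ^ 2)

/-- Euclidean norm of a vector given as a plain function. -/
noncomputable def vnorm {k : ℕ} (x : Fin k → ℝ) : ℝ :=
  Real.sqrt (∑ i, x i ^ 2)

/-- `D` is an open set which, near each boundary point and in suitable orthonormal
coordinates, coincides locally with the region strictly above the graph of a
Lipschitz function. -/
def IsLipschitzGraphDomain {m : ℕ} (D : Set (EuclideanSpace ℝ (Fin (m+1)))) : Prop :=
  IsOpen D ∧ ∀ z ∈ frontier D,
    ∃ (b : OrthonormalBasis (Fin (m+1)) ℝ (EuclideanSpace ℝ (Fin (m+1))))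
      (K : NNReal) (f : (Fin m → ℝ) → ℝ) (r : ℝ), 0 < r ∧ LipschitzWith K f ∧
      ∀ x ∈ Metric.ball z r,
        (x ∈ D ↔ f (fun i => b.repr x i.castSucc) < b.repr x (Fin.last m))

/-- `Aff*`: piecewise affine maps with maximal-rank constraint: for `n < m`, the Clarke
subgradients `A` satisfy `det (Aᵀ A) ≥ η > 0` uniformly; for `n = m`, `det ∇v > 0` a.e. -/
def AffStar {n m : ℕ} (v : EuclideanSpace ℝ (Fin n) → (Fin m → ℝ))
    (Ω : Set (EuclideanSpace ℝ (Fin n))) : Prop :=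
  PiecewiseAffineOn v Ω ∧
  ((n < m ∧ ∃ η > (0:ℝ), ∀ x ∈ Ω, ∀ A ∈ clarkeSubdiff v x,
      η ≤ ((clmMat A).transpose * clmMat A).det) ∨
   (∃ h : n = m, ∀ᵐ x ∂(volume.restrict Ω), DifferentiableAt ℝ v x ∧
      0 < ((jacMat v x).submatrix (finCongr h) id).det))

/-- Cross product in ℝ³. -/
def cross3 (u v : Fin 3 → ℝ) : Fin 3 → ℝ :=
  ![u 1 * v 2 - u 2 * v 1, u 2 * v 0 - u 0 * v 2, u 0 * v 1 - u 1 * v 0]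

/-- The 3×3 matrix `(A|ζ)` whose first two columns are those of `A` and last column is `ζ`. -/
def aug (A : Matrix (Fin 3) (Fin 2) ℝ) (ζ : Fin 3 → ℝ) : Matrix (Fin 3) (Fin 3) ℝ :=
  Matrix.of fun i j => if h : (j : ℕ) < 2 then A i ⟨j, h⟩ else ζ i

/-- The cross product `A¹ ∧ A²` of the two columns of `A`. -/
def crossCols (A : Matrix (Fin 3) (Fin 2) ℝ) : Fin 3 → ℝ :=
  cross3 (fun i => A i 0) (fun i => A i 1)

/-- The reduced energy density `W₀(A) := inf_ζ W(A|ζ)`. -/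
noncomputable def W0fun (W : Matrix (Fin 3) (Fin 3) ℝ → ℝ≥0∞) :
    Matrix (Fin 3) (Fin 2) ℝ → ℝ≥0∞ :=
  fun A => ⨅ ζ : Fin 3 → ℝ, W (aug A ζ)

/-- A point outside the affine span extends an affinely independent family. -/
lemma aux_cons {n : ℕ} {p : Fin (n+1) → EuclideanSpace ℝ (Fin (n+1))}
    (hp : AffineIndependent ℝ p) (q : EuclideanSpace ℝ (Fin (n+1)))
    (hq : q ∉ affineSpan ℝ (Set.range p)) :
    AffineIndependent ℝ (Fin.cons q p : Fin (n+2) → EuclideanSpace ℝ (Fin (n+1))) := by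
  apply AffineIndependent.affineIndependent_of_notMem_span (i := 0)
  · have h := hp.comp_embedding
      (⟨fun y : {y : Fin (n+2) // y ≠ 0} => y.1.pred y.2, by
        intro a b h
        exact Subtype.ext (Fin.pred_inj.1 h)⟩ : {y : Fin (n+2) // y ≠ 0} ↪ Fin (n+1))
    have h2 : (fun y : {y : Fin (n+2) // y ≠ 0} =>
        (Fin.cons q p : Fin (n+2) → EuclideanSpace ℝ (Fin (n+1))) y)
        = fun y => p (y.1.pred y.2) := by
      funext ⟨y, hy⟩
      obtain ⟨z, rfl⟩ := Fin.exists_succ_eq.2 hy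
      simp
    rw [h2]
    exact h
  · have : (Fin.cons q p : Fin (n+2) → EuclideanSpace ℝ (Fin (n+1))) '' {x | x ≠ 0}
        = Set.range p := by
      ext x
      constructor
      · rintro ⟨y, hy, rfl⟩
        obtain ⟨z, rfl⟩ := Fin.exists_succ_eq.2 hy
        exact ⟨z, by simp⟩
      · rintro ⟨z, rfl⟩
        exact ⟨z.succ, Fin.succ_ne_zero z, by simp⟩
    rw [this]
    simpa using hq

lemma aux_comb {E ι : Type*} [AddCommGroup E] [Module ℝ E] [Fintype ι]
    (f : E →ᵃ[ℝ] ℝ) (w : ι → ℝ) (p : ι → E) (hw : ∑ i, w i = 1) :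
    f (∑ i, w i • p i) = ∑ i, w i * f (p i) := by
  have h : ∀ x, f x = f.linear x + f 0 := fun x => congrFun f.decomp x
  rw [h, map_sum]
  have : ∀ i, w i * f (p i) = f.linear (w i • p i) + w i * f 0 := by
    intro i
    rw [h (p i), map_smul, smul_eq_mul]; ring
  simp_rw [this]
  rw [Finset.sum_add_distrib, ← Finset.sum_mul, hw, one_mul]

lemma aux_add {E : Type*} [AddCommGroup E] [Module ℝ E]
    (f : E →ᵃ[ℝ] ℝ) (x e : E) (s : ℝ) : f (x + s • e) = f x + s * f.linear e := by
  have h := f.map_vadd x (s • e)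
  simp only [vadd_eq_add, map_smul, smul_eq_mul] at h
  rw [add_comm x, h]; ring

/-- Adapted affine coordinates. -/
structure Co {n : ℕ} (p : Fin (n+1) → EuclideanSpace ℝ (Fin (n+1)))
    (lam : Fin (n+1) → EuclideanSpace ℝ (Fin (n+1)) →ᵃ[ℝ] ℝ)
    (tau : EuclideanSpace ℝ (Fin (n+1)) →ᵃ[ℝ] ℝ)
    (e : EuclideanSpace ℝ (Fin (n+1))) : Prop where
  sum_lam : ∀ x, ∑ i, lam i x = 1
  lam_e : ∀ (x : EuclideanSpace ℝ (Fin (n+1))) (s : ℝ) (i : Fin (n+1)), lam i (x + s • e) = lam i x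
  tau_e : ∀ (x : EuclideanSpace ℝ (Fin (n+1))) (s : ℝ), tau (x + s • e) = tau x + s
  decomp : ∀ x, x = ∑ i, lam i x • p i + tau x • e
  lam_p : ∀ i j, lam i (p j) = if i = j then 1 else 0
  tau_p : ∀ i, tau (p i) = 0

lemma co_exists {n : ℕ} {p : Fin (n+1) → EuclideanSpace ℝ (Fin (n+1))}
    (hp : AffineIndependent ℝ p) : ∃ lam tau e, Co p lam tau e := by
  obtain ⟨q, hq⟩ : ∃ q, q ∉ affineSpan ℝ (Set.range p) := by
    by_contra! h
    have h1 : affineSpan ℝ (Set.range p) = ⊤ := by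
      ext x; simp [h x]
    rw [hp.affineSpan_eq_top_iff_card_eq_finrank_add_one] at h1
    simp at h1
  have hc := aux_cons hp q hq
  let b : AffineBasis (Fin (n+2)) ℝ (EuclideanSpace ℝ (Fin (n+1))) :=
    ⟨_, hc, by rw [hc.affineSpan_eq_top_iff_card_eq_finrank_add_one]; simp⟩
  have hb : ∀ i, b i = (Fin.cons q p : Fin (n+2) → EuclideanSpace ℝ (Fin (n+1))) i :=
    fun i => rfl
  have hb0 : b 0 = q := rfl
  have hbs : ∀ i : Fin (n+1), b i.succ = p i := fun i => by rw [hb]; simp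
  have c00 : b.coord 0 q = 1 := by rw [← hb0]; simp
  have c0p : ∀ i, b.coord 0 (p i) = 0 := by
    intro i; rw [← hbs]; rw [b.coord_apply]; simp [(Fin.succ_ne_zero i).symm]
  have csq : ∀ i : Fin (n+1), b.coord i.succ q = 0 := by
    intro i; rw [← hb0]; rw [b.coord_apply]; simp [(Fin.succ_ne_zero i)]
  have csp : ∀ i j : Fin (n+1), b.coord i.succ (p j) = if i = j then 1 else 0 := by
    intro i j; rw [← hbs]; rw [b.coord_apply]; simp
  have hl : ∀ f : EuclideanSpace ℝ (Fin (n+1)) →ᵃ[ℝ] ℝ, f.linear (q - p 0) = f q - f (p 0) :=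
    fun f => f.linearMap_vsub q (p 0)
  refine ⟨fun i => b.coord i.succ + (if i = 0 then (1:ℝ) else 0) • b.coord 0, b.coord 0, q - p 0,
    ?_, ?_, ?_, ?_, ?_, ?_⟩
  · intro x
    have := b.sum_coord_apply_eq_one x
    rw [Fin.sum_univ_succ] at this
    simp only [AffineMap.coe_add, AffineMap.coe_smul, Pi.add_apply, Pi.smul_apply, smul_eq_mul]
    simp [Finset.sum_add_distrib]
    linarith
  · intro x s i
    rw [aux_add, hl]
    simp only [AffineMap.coe_add, AffineMap.coe_smul, Pi.add_apply, Pi.smul_apply, smul_eq_mul,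
      csq, csp, c00, c0p]
    simp
  · intro x s
    rw [aux_add, hl, c00, c0p]; ring
  · intro x
    have := b.linear_combination_coord_eq_self x
    rw [Fin.sum_univ_succ, hb0] at this
    simp_rw [hbs] at this
    conv_lhs => rw [← this]
    simp only [AffineMap.coe_add, AffineMap.coe_smul, Pi.add_apply, Pi.smul_apply, smul_eq_mul]
    simp [add_smul, Finset.sum_add_distrib, smul_sub]
    abel
  · intro i j
    simp only [AffineMap.coe_add, AffineMap.coe_smul, Pi.add_apply, Pi.smul_apply, smul_eq_mul]
    simp [csp, c0p]
  · exact c0p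

/-- minimum of the coordinates -/
def mn {n : ℕ} (lam : Fin (n+1) → EuclideanSpace ℝ (Fin (n+1)) →ᵃ[ℝ] ℝ)
    (x : EuclideanSpace ℝ (Fin (n+1))) : ℝ :=
  Finset.univ.inf' ⟨0, Finset.mem_univ 0⟩ (fun i => lam i x)

lemma mn_cont {n : ℕ} (lam : Fin (n+1) → EuclideanSpace ℝ (Fin (n+1)) →ᵃ[ℝ] ℝ) :
    Continuous (mn lam) := by
  apply Continuous.finset_inf'_apply
  intro i _
  exact (lam i).continuous_of_finiteDimensional

lemma le_mn {n : ℕ} (lam : Fin (n+1) → EuclideanSpace ℝ (Fin (n+1)) →ᵃ[ℝ] ℝ)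
    (x : EuclideanSpace ℝ (Fin (n+1))) (a : ℝ) : a ≤ mn lam x ↔ ∀ i, a ≤ lam i x :=
  (Finset.le_inf'_iff _ _).trans (by simp)

lemma lt_mn {n : ℕ} (lam : Fin (n+1) → EuclideanSpace ℝ (Fin (n+1)) →ᵃ[ℝ] ℝ)
    (x : EuclideanSpace ℝ (Fin (n+1))) (a : ℝ) : a < mn lam x ↔ ∀ i, a < lam i x :=
  (Finset.lt_inf'_iff _).trans (by simp)

lemma mn_le {n : ℕ} (lam : Fin (n+1) → EuclideanSpace ℝ (Fin (n+1)) →ᵃ[ℝ] ℝ)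
    (x : EuclideanSpace ℝ (Fin (n+1))) (i) : mn lam x ≤ lam i x :=
  (le_mn lam x _).1 le_rfl i

lemma mn_ex {n : ℕ} (lam : Fin (n+1) → EuclideanSpace ℝ (Fin (n+1)) →ᵃ[ℝ] ℝ)
    (x : EuclideanSpace ℝ (Fin (n+1))) : ∃ i, mn lam x = lam i x := by
  obtain ⟨i, _, h⟩ := Finset.exists_mem_eq_inf' (s := (Finset.univ : Finset (Fin (n+1))))
    ⟨0, Finset.mem_univ 0⟩ (fun i => lam i x)
  exact ⟨i, h⟩

namespace Co
variable {n : ℕ} {p : Fin (n+1) → EuclideanSpace ℝ (Fin (n+1))}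
    {lam : Fin (n+1) → EuclideanSpace ℝ (Fin (n+1)) →ᵃ[ℝ] ℝ}
    {tau : EuclideanSpace ℝ (Fin (n+1)) →ᵃ[ℝ] ℝ}
    {e : EuclideanSpace ℝ (Fin (n+1))}

lemma mn_e (h : Co p lam tau e) (x : EuclideanSpace ℝ (Fin (n+1))) (s : ℝ) :
    mn lam (x + s • e) = mn lam x := by
  simp [mn, h.lam_e]

lemma mn_le_one (h : Co p lam tau e) (x : EuclideanSpace ℝ (Fin (n+1))) :
    mn lam x ≤ 1 := by
  by_contra! hh
  rw [lt_mn] at hh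
  have h1 := h.sum_lam x
  have h2 : ∑ i : Fin (n+1), (1:ℝ) < ∑ i, lam i x :=
    Finset.sum_lt_sum_of_nonempty ⟨0, Finset.mem_univ 0⟩ (fun i _ => hh i)
  simp at h2
  have : (0:ℝ) ≤ n := Nat.cast_nonneg n
  linarith

lemma memP (h : Co p lam tau e) (x : EuclideanSpace ℝ (Fin (n+1))) :
    x ∈ convexHull ℝ (Set.range p) ↔ tau x = 0 ∧ 0 ≤ mn lam x := by
  rw [le_mn]
  constructor
  · intro hx
    have hcv : Convex ℝ (tau ⁻¹' {0} ∩ ⋂ i, lam i ⁻¹' Ici 0) :=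
      ((convex_singleton 0).affine_preimage tau).inter
        (convex_iInter fun i => (convex_Ici 0).affine_preimage (lam i))
    have := convexHull_min (s := Set.range p) (t := tau ⁻¹' {0} ∩ ⋂ i, lam i ⁻¹' Ici 0) (by
      rintro _ ⟨j, rfl⟩
      refine ⟨h.tau_p j, Set.mem_iInter.2 fun i => ?_⟩
      simp only [Set.mem_preimage, Set.mem_Ici, h.lam_p]
      split_ifs <;> norm_num) hcv hx
    exact ⟨this.1, fun i => Set.mem_iInter.1 this.2 i⟩
  · rintro ⟨h0, h1⟩
    rw [h.decomp x, h0, zero_smul, add_zero]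
    exact (convex_convexHull ℝ _).sum_mem (fun i _ => h1 i) (h.sum_lam x)
      (fun i _ => subset_convexHull ℝ _ ⟨i, rfl⟩)

lemma pt (h : Co p lam tau e) (s : ℝ) :
    ∃ x, tau x = s ∧ ∀ i, lam i x = 1 / (n+1) := by
  have hn : ((n:ℝ)+1) ≠ 0 := by positivity
  have hw : ∑ i : Fin (n+1), (1 / ((n:ℝ)+1)) = 1 := by
    simp; field_simp
  refine ⟨∑ i, (1 / ((n:ℝ)+1)) • p i + s • e, ?_, ?_⟩
  · rw [h.tau_e, aux_comb _ _ _ hw]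
    simp [h.tau_p]
  · intro i
    rw [h.lam_e, aux_comb _ _ _ hw]
    simp [h.lam_p]

lemma apex (hp : AffineIndependent ℝ p) (h : Co p lam tau e) {k : ℝ} (hk : 0 < k) :
    ∃ q : EuclideanSpace ℝ (Fin (n+1)),
      AffineIndependent ℝ (Fin.cons q p : Fin (n+2) → EuclideanSpace ℝ (Fin (n+1))) ∧
      {x | 0 ≤ tau x ∧ tau x ≤ k * mn lam x} = convexHull ℝ (Set.range
        (Fin.cons q p : Fin (n+2) → EuclideanSpace ℝ (Fin (n+1)))) := by
  have hn : (0:ℝ) < (n:ℝ)+1 := by positivity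
  obtain ⟨q, hq1, hq2⟩ := h.pt (k / (n+1))
  refine ⟨q, aux_cons hp q ?_, ?_⟩
  · intro hq
    have h1 : affineSpan ℝ (Set.range p) ≤ (affineSpan ℝ {(0:ℝ)}).comap tau := by
      rw [affineSpan_le]
      rintro _ ⟨i, rfl⟩
      simp [h.tau_p]
    have h2 := h1 hq
    simp [hq1] at h2
    rcases h2 with h2 | h2
    · exact hk.ne' h2
    · exact hn.ne' h2
  · have key : ∀ x, (tau x ≤ k * mn lam x ↔ ∀ i, 0 ≤ lam i x - (1/k) * tau x) := by
      intro x
      rw [← div_le_iff₀' hk, le_mn]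
      refine forall_congr' fun i => ?_
      rw [sub_nonneg]; field_simp
    ext x
    simp only [Set.mem_ofPred_eq, key]
    constructor
    · rintro ⟨h0, h1⟩
      set s := tau x / (k / (n+1)) with hs
      have hs0 : 0 ≤ s := by positivity
      have hx : x = s • q + ∑ i, (lam i x - (1/k) * tau x) • p i := by
        conv_lhs => rw [h.decomp x]
        conv_rhs => rw [h.decomp q]
        simp_rw [hq1, hq2, sub_smul, Finset.sum_sub_distrib, smul_add, Finset.smul_sum, smul_smul]
        have e1 : s * (k / (n+1)) = tau x := by rw [hs]; field_simp
        have e2 : s * (1 / (n+1)) = 1 / k * tau x := by rw [hs]; field_simp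
        rw [e1, e2]; abel
      have hsum : s + ∑ i, (lam i x - (1/k) * tau x) = 1 := by
        rw [Finset.sum_sub_distrib, h.sum_lam]
        simp [hs]; field_simp; ring
      rw [hx]
      have := (convex_convexHull ℝ (Set.range
        (Fin.cons q p : Fin (n+2) → EuclideanSpace ℝ (Fin (n+1))))).sum_mem
        (t := Finset.univ) (w := (Fin.cons s fun i => lam i x - (1/k) * tau x : Fin (n+2) → ℝ))
        (z := (Fin.cons q p : Fin (n+2) → EuclideanSpace ℝ (Fin (n+1))))
        (by
          intro i _
          refine Fin.cases ?_ (fun j => ?_) i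
          · simpa using hs0
          · simpa using h1 j)
        (by rw [Fin.sum_univ_succ]; simpa using hsum)
        (fun i _ => subset_convexHull ℝ _ ⟨i, rfl⟩)
      rw [Fin.sum_univ_succ] at this
      simpa using this
    · intro hx
      have hcv : Convex ℝ (tau ⁻¹' Ici 0 ∩ ⋂ i, (lam i - (1/k) • tau) ⁻¹' Ici 0) :=
        ((convex_Ici 0).affine_preimage tau).inter
          (convex_iInter fun i => (convex_Ici 0).affine_preimage (lam i - (1/k) • tau))
      have := convexHull_min (t := tau ⁻¹' Ici 0 ∩ ⋂ i, (lam i - (1/k) • tau) ⁻¹' Ici 0) (by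
        rintro _ ⟨j, rfl⟩
        refine Fin.cases ?_ (fun j => ?_) j
        · refine ⟨?_, Set.mem_iInter.2 fun i => ?_⟩
          · simp [hq1]; positivity
          · simp [hq1, hq2]; apply le_of_eq; field_simp
        · refine ⟨?_, Set.mem_iInter.2 fun i => ?_⟩
          · simp [h.tau_p]
          · simp only [Set.mem_preimage, Fin.cons_succ, AffineMap.coe_sub, AffineMap.coe_smul,
              Pi.sub_apply, Pi.smul_apply, h.tau_p, h.lam_p, Set.mem_Ici, smul_zero, sub_zero]
            split_ifs <;> norm_num) hcv hx
      refine ⟨this.1, fun i => ?_⟩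
      simpa using Set.mem_iInter.1 this.2 i

end Co

lemma aux_null {n : ℕ} (f : EuclideanSpace ℝ (Fin (n+1)) →ᵃ[ℝ] ℝ)
    (a : EuclideanSpace ℝ (Fin (n+1))) (ha : f a ≠ 0) :
    volume {x | f x = 0} = 0 := by
  have h := Measure.addHaar_affineSubspace (volume : Measure (EuclideanSpace ℝ (Fin (n+1))))
    ((affineSpan ℝ {(0:ℝ)}).comap f) (by
      intro h
      have : a ∈ (affineSpan ℝ {(0:ℝ)}).comap f := by rw [h]; trivial
      simp [ha] at this)
  convert h using 2
  ext x; simp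

lemma cont_aux {X : Type*} [TopologicalSpace X] {t a : X → ℝ} (ht : Continuous t)
    (ha : Continuous a) {S : Set X}
    (hS : ∀ x ∈ S, t x = 0 → ∀ᶠ y in nhds x, 0 < t y → a y = 0) :
    ContinuousOn (fun x => if 0 < t x then a x else 0) S := by
  intro x hx
  apply ContinuousAt.continuousWithinAt
  rcases lt_trichotomy (t x) 0 with h | h | h
  · have : (fun x => if 0 < t x then a x else 0) =ᶠ[nhds x] fun _ => 0 := by
      filter_upwards [ht.continuousAt.eventually (gt_mem_nhds h)] with y hy
      rw [if_neg (not_lt.2 hy.le)]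
    exact continuousAt_const.congr this.symm
  · have : (fun x => if 0 < t x then a x else 0) =ᶠ[nhds x] fun _ => 0 := by
      filter_upwards [hS x hx h] with y hy
      split_ifs with h1
      · exact hy h1
      · rfl
    exact continuousAt_const.congr this.symm
  · have : (fun x => if 0 < t x then a x else 0) =ᶠ[nhds x] a := by
      filter_upwards [ht.continuousAt.eventually (lt_mem_nhds h)] with y hy
      rw [if_pos hy]
    exact ha.continuousAt.congr this.symm

section
variable {n : ℕ} (lam : Fin (n+1) → EuclideanSpace ℝ (Fin (n+1)) →ᵃ[ℝ] ℝ)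
    (tau : EuclideanSpace ℝ (Fin (n+1)) →ᵃ[ℝ] ℝ)
    (e : EuclideanSpace ℝ (Fin (n+1))) (k c : ℝ)

/-- the deformation -/
def PhiD (x : EuclideanSpace ℝ (Fin (n+1))) : EuclideanSpace ℝ (Fin (n+1)) :=
  x + (if 0 < tau x then max 0 (k * mn lam x - c * tau x) else 0) • e

/-- the inverse deformation -/
def PsiD (x : EuclideanSpace ℝ (Fin (n+1))) : EuclideanSpace ℝ (Fin (n+1)) :=
  x + (if 0 < tau x then min 0 ((c * tau x - k * mn lam x) / (1 - c)) else 0) • e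

/-- the pieces -/
def VD : Option (Fin (n+1)) → Set (EuclideanSpace ℝ (Fin (n+1)))
  | none => {x | tau x < 0} ∪ {x | 0 < tau x ∧ k * mn lam x < c * tau x}
  | some i => {x | 0 < tau x ∧ c * tau x < k * lam i x ∧ ∀ j, j ≠ i → lam i x < lam j x}

/-- continuous linear part -/
def lin (f : EuclideanSpace ℝ (Fin (n+1)) →ᵃ[ℝ] ℝ) : EuclideanSpace ℝ (Fin (n+1)) →L[ℝ] ℝ :=
  LinearMap.toContinuousLinearMap f.linear

/-- linear parts -/
def LD : Option (Fin (n+1)) → EuclideanSpace ℝ (Fin (n+1)) →L[ℝ] EuclideanSpace ℝ (Fin (n+1))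
  | none => ContinuousLinearMap.id ℝ _
  | some i => ContinuousLinearMap.id ℝ _ + (k • lin (lam i) - c • lin tau).smulRight e

/-- translation parts -/
def cD : Option (Fin (n+1)) → EuclideanSpace ℝ (Fin (n+1))
  | none => 0
  | some i => (k * lam i 0 - c * tau 0) • e

lemma lin_eq (f : EuclideanSpace ℝ (Fin (n+1)) →ᵃ[ℝ] ℝ) (x) : f x = lin f x + f 0 := by
  rw [lin, LinearMap.coe_toContinuousLinearMap']
  exact congrFun f.decomp x

lemma VD_open (o) : IsOpen (VD lam tau k c o) := by
  have h1 := tau.continuous_of_finiteDimensional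
  have h2 := mn_cont lam
  have h3 := fun i => (lam i).continuous_of_finiteDimensional
  cases o with
  | none =>
    exact (isOpen_lt h1 continuous_const).union ((isOpen_lt continuous_const h1).inter
      (isOpen_lt (h2.const_mul k) (h1.const_mul c)))
  | some i =>
    refine (isOpen_lt continuous_const h1).inter
      ((isOpen_lt (h1.const_mul c) ((h3 i).const_mul k)).inter ?_)
    have : {x | ∀ j, j ≠ i → lam i x < lam j x} = ⋂ j, ⋂ (_ : j ≠ i), {x | lam i x < lam j x} := by
      ext x; simp
    change IsOpen {x | ∀ j, j ≠ i → lam i x < lam j x}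
    rw [this]
    exact isOpen_iInter_of_finite fun j => isOpen_iInter_of_finite fun _ => isOpen_lt (h3 i) (h3 j)

lemma mn_some {x} {i} (h : ∀ j, j ≠ i → lam i x < lam j x) : mn lam x = lam i x := by
  apply le_antisymm (mn_le _ _ _)
  rw [le_mn]
  intro j
  by_cases hj : j = i
  · rw [hj]
  · exact (h j hj).le

lemma VD_disj (o o') (ho : o ≠ o') : Disjoint (VD lam tau k c o) (VD lam tau k c o') := by
  have key : ∀ i x, x ∈ VD lam tau k c none → x ∈ VD lam tau k c (some i) → False := by
    rintro i x hx ⟨h1, h2, h3⟩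
    rcases hx with hx | ⟨_, hx⟩
    · exact lt_asymm h1 hx
    · rw [mn_some lam h3] at hx
      exact lt_asymm h2 hx
  rw [Set.disjoint_left]
  intro x hx hx'
  cases o with
  | none =>
    cases o' with
    | none => exact ho rfl
    | some i => exact key i x hx hx'
  | some i =>
    cases o' with
    | none => exact key i x hx' hx
    | some j =>
      have hij : i ≠ j := fun h => ho (by rw [h])
      exact lt_asymm (hx.2.2 j hij.symm) (hx'.2.2 i hij)

lemma PhiD_on (o) (x) (hx : x ∈ VD lam tau k c o) :
    PhiD lam tau e k c x = LD lam tau e k c o x + cD lam tau e k c o := by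
  cases o with
  | none =>
    rcases hx with hx | ⟨h1, h2⟩
    · have : ¬ 0 < tau x := not_lt.2 (le_of_lt hx)
      simp [PhiD, LD, cD, this]
    · have : max 0 (k * mn lam x - c * tau x) = 0 := max_eq_left (by linarith)
      simp [PhiD, LD, cD, h1, this]
  | some i =>
    obtain ⟨h1, h2, h3⟩ := hx
    have h4 := mn_some lam h3
    have : max 0 (k * lam i x - c * tau x) = k * lam i x - c * tau x :=
      max_eq_right (by linarith)
    simp only [PhiD, LD, cD, h1, if_true, h4, this]
    rw [lin_eq (lam i) x, lin_eq tau x]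
    simp only [_root_.add_apply, ContinuousLinearMap.smulRight_apply,
      _root_.sub_apply, _root_.smul_apply, smul_eq_mul,
      ContinuousLinearMap.id_apply]
    rw [add_assoc, ← add_smul]
    congr 2; ring

lemma LD_norm (hk : 0 ≤ k) (hc : 0 ≤ c) (o) :
    ‖LD lam tau e k c o - ContinuousLinearMap.id ℝ _‖ ≤
      (k + c) * (∑ i, ‖lin (lam i)‖ + ‖lin tau‖) * ‖e‖ := by
  have hs : 0 ≤ ∑ i, ‖lin (lam i)‖ := Finset.sum_nonneg fun i _ => norm_nonneg _
  cases o with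
  | none =>
    simp only [LD, sub_self, norm_zero]
    positivity
  | some i =>
    simp only [LD, add_sub_cancel_left, ContinuousLinearMap.norm_smulRight_apply]
    gcongr
    have h1 : ‖lin (lam i)‖ ≤ ∑ i, ‖lin (lam i)‖ :=
      Finset.single_le_sum (f := fun i => ‖lin (lam i)‖) (fun i _ => norm_nonneg _)
        (Finset.mem_univ i)
    calc _ ≤ ‖k • lin (lam i)‖ + ‖c • lin tau‖ := norm_sub_le _ _
      _ = k * ‖lin (lam i)‖ + c * ‖lin tau‖ := by
        rw [norm_smul, norm_smul, Real.norm_of_nonneg hk, Real.norm_of_nonneg hc]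
      _ ≤ k * ∑ i, ‖lin (lam i)‖ + c * ‖lin tau‖ := by gcongr
      _ ≤ _ := by nlinarith [norm_nonneg (lin tau), mul_nonneg hc hs,
                    mul_nonneg hk (norm_nonneg (lin tau))]
end

namespace Co
variable {n : ℕ} {p : Fin (n+1) → EuclideanSpace ℝ (Fin (n+1))}
    {lam : Fin (n+1) → EuclideanSpace ℝ (Fin (n+1)) →ᵃ[ℝ] ℝ}
    {tau : EuclideanSpace ℝ (Fin (n+1)) →ᵃ[ℝ] ℝ}
    {e : EuclideanSpace ℝ (Fin (n+1))} {k c : ℝ}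

lemma VD_null (h : Co p lam tau e) (hc : 0 < c) :
    volume (⋃ o, VD lam tau k c o)ᶜ = 0 := by
  have hsub : (⋃ o, VD lam tau k c o)ᶜ ⊆ {x | tau x = 0} ∪
      ((⋃ i, {x | (k • lam i - c • tau) x = 0}) ∪
        ⋃ i, ⋃ j, ⋃ (_ : j ≠ i), {x | (lam i - lam j) x = 0}) := by
    intro x hx
    by_contra hn
    simp only [Set.mem_union, Set.mem_iUnion, not_or, not_exists, Set.mem_ofPred_eq,
      AffineMap.coe_sub, AffineMap.coe_smul, Pi.sub_apply, Pi.smul_apply, smul_eq_mul,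
      sub_eq_zero] at hn
    obtain ⟨h0, h1, h2⟩ := hn
    apply hx
    rw [Set.mem_iUnion]
    rcases lt_or_gt_of_ne h0 with h0 | h0
    · exact ⟨none, Or.inl h0⟩
    · by_cases h3 : k * mn lam x < c * tau x
      · exact ⟨none, Or.inr ⟨h0, h3⟩⟩
      · obtain ⟨i, hi⟩ := mn_ex lam x
        rw [hi] at h3
        refine ⟨some i, h0, lt_of_le_of_ne (not_lt.1 h3) (Ne.symm (h1 i)), fun j hj => ?_⟩
        exact lt_of_le_of_ne (hi ▸ mn_le lam x j) (h2 i j hj)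
  refine measure_mono_null hsub ?_
  have ht : tau (0 + (1 - tau 0) • e) = 1 := by rw [h.tau_e]; ring
  rw [measure_union_null_iff, measure_union_null_iff, measure_iUnion_null_iff,
    measure_iUnion_null_iff]
  refine ⟨aux_null _ _ (by rw [ht]; norm_num), fun i => ?_, fun i => ?_⟩
  · refine aux_null _ (0 + ((k * lam i 0 - 1) / c - tau 0) • e) ?_
    simp only [AffineMap.coe_sub, AffineMap.coe_smul, Pi.sub_apply, Pi.smul_apply, smul_eq_mul,
      h.lam_e, h.tau_e]
    field_simp
    ring_nf
    norm_num
  · rw [measure_iUnion_null_iff]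
    intro j
    rw [measure_iUnion_null_iff]
    intro hj
    refine aux_null _ (p i) ?_
    simp [h.lam_p, hj]

lemma PhiD_cont (h : Co p lam tau e) (hk : 0 < k) (hc : 0 < c) :
    ContinuousOn (PhiD lam tau e k c) (convexHull ℝ (Set.range p))ᶜ := by
  have h1 := tau.continuous_of_finiteDimensional
  have h2 := mn_cont lam
  refine continuousOn_id.add (ContinuousOn.smul (cont_aux h1 (by fun_prop) ?_) continuousOn_const)
  intro x hx h0
  have hx' : mn lam x < 0 := by
    by_contra! hh
    exact hx ((h.memP x).2 ⟨h0, hh⟩)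
  filter_upwards [h2.continuousAt.eventually (gt_mem_nhds hx')] with y hy hy'
  apply max_eq_left
  nlinarith [mul_pos hc hy', mul_pos_of_neg_of_neg hy (neg_lt_zero.2 hk)]

lemma PsiD_cont (hk : 0 < k) (hc : 0 < c) (hc1 : c < 1) :
    ContinuousOn (PsiD lam tau e k c) {x | 0 ≤ tau x ∧ tau x ≤ k * mn lam x}ᶜ := by
  have h1 := tau.continuous_of_finiteDimensional
  have h2 := mn_cont lam
  refine continuousOn_id.add (ContinuousOn.smul (cont_aux h1 (by fun_prop) ?_) continuousOn_const)
  intro x hx h0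
  have hx' : mn lam x < 0 := by
    by_contra! hh
    exact hx ⟨h0.ge, by rw [h0]; positivity⟩
  filter_upwards [h2.continuousAt.eventually (gt_mem_nhds hx')] with y hy hy'
  apply min_eq_left
  apply div_nonneg _ (by linarith)
  nlinarith [mul_pos hc hy', mul_pos_of_neg_of_neg hy (neg_lt_zero.2 hk)]

lemma PhiD_maps (h : Co p lam tau e) (hk : 0 < k) (hc1 : c < 1) :
    Set.MapsTo (PhiD lam tau e k c) (convexHull ℝ (Set.range p))ᶜ
      {x | 0 ≤ tau x ∧ tau x ≤ k * mn lam x}ᶜ := by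
  rintro x hx ⟨h1, h2⟩
  rw [PhiD, h.tau_e] at h1 h2
  rw [h.mn_e] at h2
  split_ifs at h1 h2 with h3
  · have := le_max_right 0 (k * mn lam x - c * tau x)
    nlinarith
  · have h0 : tau x = 0 := by linarith
    refine hx ((h.memP x).2 ⟨h0, ?_⟩)
    rw [h0] at h2
    by_contra! hh
    nlinarith

lemma PsiD_maps (h : Co p lam tau e) (hk : 0 < k) (hc1 : c < 1) :
    Set.MapsTo (PsiD lam tau e k c) {x | 0 ≤ tau x ∧ tau x ≤ k * mn lam x}ᶜ
      (convexHull ℝ (Set.range p))ᶜ := by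
  intro x hx hP
  rw [h.memP] at hP
  obtain ⟨h1, h2⟩ := hP
  rw [PsiD, h.tau_e] at h1
  rw [PsiD, h.mn_e] at h2
  split_ifs at h1 with h3
  · have h4 : k * mn lam x < tau x := by
      by_contra! hh
      exact hx ⟨h3.le, hh⟩
    rcases min_cases 0 ((c * tau x - k * mn lam x) / (1 - c)) with ⟨h5, _⟩ | ⟨h5, _⟩
    · rw [h5] at h1; linarith
    · rw [h5] at h1
      have : (1 - c) ≠ 0 := by linarith
      field_simp at h1
      linarith
  · exact hx ⟨by linarith, by nlinarith [mul_nonneg hk.le h2]⟩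

lemma Psi_Phi (h : Co p lam tau e) (hc1 : c < 1) (x) :
    PsiD lam tau e k c (PhiD lam tau e k c x) = x := by
  by_cases h3 : 0 < tau x
  · simp only [PhiD, if_pos h3]
    rcases max_cases 0 (k * mn lam x - c * tau x) with ⟨h5, h6⟩ | ⟨h5, h6⟩
    · rw [h5, zero_smul, add_zero, PsiD, if_pos h3, min_eq_left, zero_smul, add_zero]
      exact div_nonneg (by linarith) (by linarith)
    · rw [h5, PsiD, h.tau_e, h.mn_e, if_pos (by linarith), add_assoc, ← add_smul]
      have h7 : (c * (tau x + (k * mn lam x - c * tau x)) - k * mn lam x) / (1 - c)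
          = - (k * mn lam x - c * tau x) := by
        have : (1 - c) ≠ 0 := by linarith
        field_simp; ring
      rw [h7, min_eq_right (by linarith)]
      simp
  · simp [PhiD, PsiD, h3]

lemma Phi_Psi (h : Co p lam tau e) (hc : 0 < c) (hc1 : c < 1) (x)
    (hx : x ∈ {x | 0 ≤ tau x ∧ tau x ≤ k * mn lam x}ᶜ) :
    PhiD lam tau e k c (PsiD lam tau e k c x) = x := by
  by_cases h3 : 0 < tau x
  · have h4 : k * mn lam x < tau x := by
      by_contra! hh
      exact hx ⟨h3.le, hh⟩
    have hc2 : 0 < 1 - c := by linarith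
    simp only [PsiD, if_pos h3]
    rcases min_cases 0 ((c * tau x - k * mn lam x) / (1 - c)) with ⟨h5, h6⟩ | ⟨h5, h6⟩
    · rw [h5, zero_smul, add_zero, PhiD, if_pos h3, max_eq_left, zero_smul, add_zero]
      by_contra! hneg
      have := div_neg_of_neg_of_pos (show c * tau x - k * mn lam x < 0 by linarith) hc2
      linarith
    · have h8 : tau x + (c * tau x - k * mn lam x) / (1 - c)
          = (tau x - k * mn lam x) / (1 - c) := by
        field_simp; ring
      rw [h5, PhiD, h.tau_e, h.mn_e, if_pos (by rw [h8]; exact div_pos (by linarith) hc2),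
        add_assoc, ← add_smul]
      have h7 : k * mn lam x - c * (tau x + (c * tau x - k * mn lam x) / (1 - c))
          = - ((c * tau x - k * mn lam x) / (1 - c)) := by
        field_simp; ring
      rw [h7, max_eq_right (by linarith)]
      simp
  · simp [PhiD, PsiD, h3]

lemma PhiD_far (h : Co p lam tau e) (hk : 0 < k) (hc : 0 < c) {δ : ℝ}
    (hd : k * ‖e‖ < c * δ) (x) (hx : x ∉ Metric.thickening δ (convexHull ℝ (Set.range p))) :
    PhiD lam tau e k c x = x := by
  by_cases h3 : 0 < tau x
  · rcases max_cases 0 (k * mn lam x - c * tau x) with ⟨h5, h6⟩ | ⟨h5, h6⟩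
    · simp [PhiD, h3, h5]
    · exfalso
      apply hx
      have hm : 0 < mn lam x := by
        by_contra! hh
        nlinarith [mul_pos hc h3]
      rw [Metric.mem_thickening_iff]
      refine ⟨x + (-tau x) • e, ?_, ?_⟩
      · rw [h.memP, h.tau_e, h.mn_e]
        exact ⟨by ring, hm.le⟩
      · rw [dist_eq_norm]
        simp only [neg_smul, ← sub_eq_add_neg, sub_sub_cancel]
        rw [norm_smul, Real.norm_of_nonneg h3.le]
        have h7 := h.mn_le_one x
        have h8 : c * tau x ≤ k := by nlinarith
        have h9 : c * tau x * ‖e‖ ≤ k * ‖e‖ := by gcongr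
        by_contra! h10
        nlinarith
  · simp [PhiD, h3]

lemma PhiD_near (h : Co p lam tau e) (hk : 0 < k) (hc : 0 < c) (x) :
    ‖PhiD lam tau e k c x - x‖ ≤ k * ‖e‖ := by
  rw [PhiD, add_sub_cancel_left, norm_smul]
  gcongr
  split_ifs with h3
  · rw [Real.norm_of_nonneg (le_max_left _ _)]
    apply max_le hk.le
    nlinarith [h.mn_le_one x, mul_pos hc h3]
  · simpa using hk.le

lemma VD_sub (h : Co p lam tau e) (o) :
    VD lam tau k c o ⊆ (convexHull ℝ (Set.range p))ᶜ := by
  intro x hx hP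
  have h0 := ((h.memP x).1 hP).1
  cases o with
  | none =>
    rcases hx with hx | hx
    · exact hx.ne h0
    · exact hx.1.ne' h0
  | some i => exact hx.1.ne' h0

lemma PhiD_pwa (h : Co p lam tau e) (hk : 0 < k) (hc : 0 < c) :
    PiecewiseAffineOn (PhiD lam tau e k c) (convexHull ℝ (Set.range p))ᶜ := by
  refine ⟨h.PhiD_cont hk hc, ?_⟩
  let E := Fintype.equivFin (Option (Fin (n+1)))
  refine ⟨_, fun i => VD lam tau k c (E.symm i), fun i => VD_open _ _ _ _ _,
    fun i => h.VD_sub _, fun i j hij => VD_disj _ _ _ _ _ _ fun hh => hij (E.symm.injective hh),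
    ?_, fun i => ⟨_, _, fun x hx => PhiD_on lam tau e k c _ x hx⟩⟩
  refine measure_mono_null ?_ (h.VD_null (k := k) hc)
  rintro x ⟨_, hx⟩ hx'
  obtain ⟨o, ho⟩ := Set.mem_iUnion.1 hx'
  exact hx (Set.mem_iUnion.2 ⟨E o, by simpa using ho⟩)

lemma PhiD_fderiv (h : Co p lam tau e) (hk : 0 < k) (hc : 0 < c) :
    ∀ᵐ x : EuclideanSpace ℝ (Fin (n+1)), DifferentiableAt ℝ (PhiD lam tau e k c) x ∧
      ‖fderiv ℝ (PhiD lam tau e k c) x - ContinuousLinearMap.id ℝ _‖ ≤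
      (k + c) * (∑ i, ‖lin (lam i)‖ + ‖lin tau‖) * ‖e‖ := by
  have h0 : ∀ᵐ x : EuclideanSpace ℝ (Fin (n+1)), x ∈ ⋃ o, VD lam tau k c o := by
    rw [ae_iff]
    exact h.VD_null (k := k) hc
  filter_upwards [h0] with x hx
  obtain ⟨o, ho⟩ := Set.mem_iUnion.1 hx
  have h1 : HasFDerivAt (PhiD lam tau e k c) (LD lam tau e k c o) x := by
    have h2 : HasFDerivAt (fun y => LD lam tau e k c o y + cD lam tau e k c o)
        (LD lam tau e k c o) x := (LD lam tau e k c o).hasFDerivAt.add_const _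
    refine h2.congr_of_eventuallyEq ?_
    filter_upwards [(VD_open lam tau k c o).mem_nhds ho] with y hy
    exact PhiD_on lam tau e k c o y hy
  refine ⟨h1.differentiableAt, ?_⟩
  rw [h1.fderiv]
  exact LD_norm lam tau e k c hk.le hc.le o

end Co

lemma aux_lip_inf {n : ℕ} {ι : Type*} (A : Finset ι) (hA : A.Nonempty)
    (F : ι → (Fin n → ℝ) → ℝ) (hF : ∀ i ∈ A, ∃ K, LipschitzWith K (F i)) :
    ∃ K, LipschitzWith K (A.inf' hA F) := by
  refine Finset.inf'_induction hA F (p := fun f => ∃ K, LipschitzWith K f) ?_ hF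
  rintro f ⟨K, hf⟩ g ⟨K', hg⟩
  exact ⟨_, hf.min hg⟩

lemma aux_lip {n : ℕ} {ι : Type*} [Fintype ι]
    (l : ι → EuclideanSpace ℝ (Fin (n+1)) →ᵃ[ℝ] ℝ)
    (a : EuclideanSpace ℝ (Fin (n+1))) (ha : ∀ j, l j a < 0) :
    IsLipschitzGraphDomain (m := n) {x | ∀ j, l j x ≤ 0}ᶜ := by
  classical
  have hcont := fun j => (l j).continuous_of_finiteDimensional
  have hcl : IsClosed {x | ∀ j, l j x ≤ 0} := by
    have : {x | ∀ j, l j x ≤ 0} = ⋂ j, {x | l j x ≤ 0} := by ext x; simp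
    rw [this]
    exact isClosed_iInter fun j => isClosed_le (hcont j) continuous_const
  refine ⟨hcl.isOpen_compl, fun z hz => ?_⟩
  rw [frontier_compl, hcl.frontier_eq] at hz
  obtain ⟨hz1, hz2⟩ := hz
  have hz1 : ∀ j, l j z ≤ 0 := hz1
  set A : Finset ι := Finset.univ.filter (fun j => l j z = 0) with hAdef
  have hnb : ∀ᶠ x in nhds z, ∀ j, j ∉ A → l j x < 0 := by
    rw [eventually_all]
    intro j
    by_cases hj : j ∈ A
    · simp [hj]
    · have : l j z < 0 := lt_of_le_of_ne (hz1 j) (by simpa [hAdef] using hj)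
      filter_upwards [(hcont j).continuousAt.eventually (gt_mem_nhds this)] with x hx _
      exact hx
  have hA : A.Nonempty := by
    by_contra hA
    rw [Finset.not_nonempty_iff_eq_empty] at hA
    apply hz2
    rw [mem_interior_iff_mem_nhds]
    filter_upwards [hnb] with x hx j
    exact (hx j (by simp [hA])).le
  obtain ⟨j0, hj0⟩ := hA
  have hA : A.Nonempty := ⟨j0, hj0⟩
  have hza : z - a ≠ 0 := by
    intro h0
    have h1 : z = a := sub_eq_zero.1 h0
    have h2 := ha j0
    rw [← h1] at h2
    have h3 : l j0 z = 0 := by simpa [hAdef] using hj0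
    linarith
  have hpos : 0 < ‖z - a‖ := norm_pos_iff.2 hza
  set u : EuclideanSpace ℝ (Fin (n+1)) := ‖z - a‖⁻¹ • (z - a) with hu
  have hun : ‖u‖ = 1 := by
    rw [hu, norm_smul, norm_inv, norm_norm, inv_mul_cancel₀ hpos.ne']
  obtain ⟨b, hb⟩ := Orthonormal.exists_orthonormalBasis_extension_of_card_eq (𝕜 := ℝ)
    (E := EuclideanSpace ℝ (Fin (n+1))) (ι := Fin (n+1)) (by simp) (v := fun _ => u)
    (s := {Fin.last n}) (by
      constructor
      · intro i; exact hun
      · intro i j hij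
        exact absurd (Subsingleton.elim i j) hij)
  have hbl : b (Fin.last n) = u := hb _ rfl
  have hd : ∀ j ∈ A, 0 < (l j).linear u := by
    intro j hj
    have h3 : l j z = 0 := by simpa [hAdef] using hj
    have h4 : (l j).linear (z - a) = l j z - l j a := (l j).linearMap_vsub z a
    rw [hu, map_smul, h4, h3, smul_eq_mul]
    have := ha j
    apply mul_pos (inv_pos.2 hpos); linarith
  let T : (Fin n → ℝ) →ₗ[ℝ] EuclideanSpace ℝ (Fin (n+1)) :=
    Fintype.linearCombination ℝ (fun i : Fin n => b i.castSucc)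
  have hx : ∀ x, x = T (fun i => b.repr x i.castSucc) + b.repr x (Fin.last n) • u := by
    intro x
    have := b.sum_repr x
    rw [Fin.sum_univ_castSucc, hbl] at this
    simp only [T, Fintype.linearCombination_apply]
    exact this.symm
  let F : ι → (Fin n → ℝ) → ℝ := fun j y => - (l j (T y)) / (l j).linear u
  have hF : ∀ j, ∃ K, LipschitzWith K (F j) := by
    intro j
    let G : (Fin n → ℝ) →L[ℝ] ℝ :=
      LinearMap.toContinuousLinearMap ((-(1 / (l j).linear u)) • ((l j).linear ∘ₗ T))
    have : F j = fun y => G y + (- (l j 0) / (l j).linear u) := by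
      funext y
      have h1 : l j (T y) = (l j).linear (T y) + l j 0 := congrFun (l j).decomp (T y)
      simp only [F, G, h1]
      simp
      ring
    rw [this]
    exact ⟨_, G.lipschitz.add (LipschitzWith.const _)⟩
  obtain ⟨K, hK⟩ := aux_lip_inf A hA F (fun j _ => hF j)
  obtain ⟨r, hr, hball⟩ := Metric.mem_nhds_iff.1 hnb
  refine ⟨b, K, _, r, hr, hK, fun x hxb => ?_⟩
  have hxn : ∀ j, j ∉ A → l j x < 0 := hball hxb
  rw [Finset.inf'_apply, Finset.inf'_lt_iff]
  have key : ∀ j ∈ A, (0 < l j x ↔ F j (fun i => b.repr x i.castSucc) < b.repr x (Fin.last n)) := by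
    intro j hj
    conv_lhs => rw [hx x, aux_add]
    simp only [F]
    rw [div_lt_iff₀ (hd j hj)]
    constructor <;> intro h <;> linarith
  constructor
  · intro hxD
    have : ∃ j, 0 < l j x := by
      by_contra! hh
      exact hxD hh
    obtain ⟨j, hj⟩ := this
    have hjA : j ∈ A := by
      by_contra hjA
      exact lt_asymm hj (hxn j hjA)
    exact ⟨j, hjA, (key j hjA).1 hj⟩
  · rintro ⟨j, hjA, hj⟩ hxS
    exact absurd ((key j hjA).2 hj) (not_lt.2 (hxS j))

lemma Co.lip {n : ℕ} {p : Fin (n+1) → EuclideanSpace ℝ (Fin (n+1))}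
    {lam : Fin (n+1) → EuclideanSpace ℝ (Fin (n+1)) →ᵃ[ℝ] ℝ}
    {tau : EuclideanSpace ℝ (Fin (n+1)) →ᵃ[ℝ] ℝ}
    {e : EuclideanSpace ℝ (Fin (n+1))} {k : ℝ} (h : Co p lam tau e) (hk : 0 < k) :
    IsLipschitzGraphDomain (m := n) {x | 0 ≤ tau x ∧ tau x ≤ k * mn lam x}ᶜ := by
  obtain ⟨a, ha1, ha2⟩ := h.pt (k / (n+1) / 2)
  have hn : (0:ℝ) < (n:ℝ)+1 := by positivity
  let l : Option (Fin (n+1)) → EuclideanSpace ℝ (Fin (n+1)) →ᵃ[ℝ] ℝ := fun o =>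
    o.elim ((-1:ℝ) • tau) (fun i => tau - k • lam i)
  have hl : ∀ j, l j a < 0 := by
    have hp : 0 < k / (n+1) := by positivity
    intro j
    cases j with
    | none => simp [l, ha1]; positivity
    | some i =>
      have : k * (1 / ((n:ℝ)+1)) = k / (n+1) := by ring
      simp only [l, Option.elim_some, AffineMap.coe_sub, AffineMap.coe_smul, Pi.sub_apply,
        Pi.smul_apply, smul_eq_mul, ha1, ha2, this]
      linarith
  have := aux_lip l a hl
  convert this using 2
  ext x
  simp only [Set.mem_ofPred_eq, Option.forall]
  refine and_congr ?_ ?_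
  · simp [l]
  · rw [← div_le_iff₀' hk, le_mn]
    refine forall_congr' fun i => ?_
    simp only [l, Option.elim_some, AffineMap.coe_sub, AffineMap.coe_smul, Pi.sub_apply,
        Pi.smul_apply, smul_eq_mul, sub_nonpos]
    rw [div_le_iff₀' hk]

/-- in ℝ^(n+1) (with n+1 ≥ 3), the complement of an (n+1-1)-dimensional
simplex `P` can be deformed onto the complement of an (n+1)-dimensional simplex `Δ δ`
with base `P`, whose complement is a Lipschitz domain, via piecewise affine
homeomorphisms `Φ δ` equal to the identity outside the δ-neighborhood of `P` and
converging to the identity in `W^{1,∞}` as `δ → 0`. -/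
theorem stmt1 {n : ℕ} (hn : 2 ≤ n)
    (P : Set (EuclideanSpace ℝ (Fin (n+1))))
    (p : Fin (n+1) → EuclideanSpace ℝ (Fin (n+1)))
    (hp : AffineIndependent ℝ p) (hP : P = convexHull ℝ (Set.range p)) :
    ∃ δ₁ > (0:ℝ), ∃ (Δ : ℝ → Set (EuclideanSpace ℝ (Fin (n+1))))
      (Φ : ℝ → EuclideanSpace ℝ (Fin (n+1)) → EuclideanSpace ℝ (Fin (n+1))),
      (∀ δ, 0 < δ → δ < δ₁ →
        -- Δ δ is an (n+1)-dimensional simplex with base P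
        (∃ q : EuclideanSpace ℝ (Fin (n+1)), AffineIndependent ℝ (Fin.cons q p) ∧
          Δ δ = convexHull ℝ (Set.range (Fin.cons q p))) ∧
        -- Φ δ is a piecewise affine homeomorphism from ℝ^(n+1) ∖ P onto ℝ^(n+1) ∖ Δ δ
        (PiecewiseAffineOn (Φ δ) Pᶜ ∧ ContinuousOn (Φ δ) Pᶜ ∧
          Set.BijOn (Φ δ) Pᶜ (Δ δ)ᶜ ∧
          (∃ Ψ : EuclideanSpace ℝ (Fin (n+1)) → EuclideanSpace ℝ (Fin (n+1)),
            ContinuousOn Ψ (Δ δ)ᶜ ∧ ∀ x ∈ Pᶜ, Ψ (Φ δ x) = x)) ∧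
        -- (i) the complement of Δ δ is a Lipschitz domain
        IsLipschitzGraphDomain (m := n) ((Δ δ)ᶜ) ∧
        -- (ii) Φ δ is the identity outside the δ-neighborhood of P
        (∀ x ∉ Metric.thickening δ P, Φ δ x = x)) ∧
      -- (iii) W^{1,∞} convergence to the identity as δ → 0
      (∀ ε > (0:ℝ), ∃ δ₂, 0 < δ₂ ∧ δ₂ ≤ δ₁ ∧ ∀ δ, 0 < δ → δ < δ₂ →
        ((∀ x ∈ Pᶜ, ‖Φ δ x - x‖ ≤ ε) ∧
         ∀ᵐ x : EuclideanSpace ℝ (Fin (n+1)), x ∈ Pᶜ →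
           DifferentiableAt ℝ (Φ δ) x ∧
           ‖fderiv ℝ (Φ δ) x - ContinuousLinearMap.id ℝ (EuclideanSpace ℝ (Fin (n+1)))‖ ≤ ε)) := by
  subst hP
  obtain ⟨lam, tau, e, h⟩ := co_exists hp
  set C : ℝ := ∑ i, ‖lin (lam i)‖ + ‖lin tau‖ with hC
  have hC0 : 0 ≤ C := by
    have hs : 0 ≤ ∑ i, ‖lin (lam i)‖ := Finset.sum_nonneg fun i _ => norm_nonneg _
    positivity
  have he := norm_nonneg e
  have he1 : 0 < ‖e‖ + 1 := by positivity
  have hkpos : ∀ δ : ℝ, 0 < δ → 0 < δ ^ 2 / (‖e‖ + 1) := fun δ hδ => by positivity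
  have hke : ∀ δ : ℝ, 0 < δ → δ ^ 2 / (‖e‖ + 1) * ‖e‖ < δ * δ := by
    intro δ hδ
    rw [div_mul_eq_mul_div, div_lt_iff₀ he1]
    nlinarith [mul_pos hδ hδ]
  have hkd : ∀ δ : ℝ, 0 < δ → δ < 1 / 2 → δ ^ 2 / (‖e‖ + 1) ≤ δ := by
    intro δ hδ h2
    rw [div_le_iff₀ he1]
    nlinarith [mul_nonneg hδ.le he]
  refine ⟨1/2, by norm_num,
    fun δ => {x | 0 ≤ tau x ∧ tau x ≤ (δ ^ 2 / (‖e‖ + 1)) * mn lam x},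
    fun δ => PhiD lam tau e (δ ^ 2 / (‖e‖ + 1)) δ, ?_, ?_⟩
  · intro δ hδ hδ1
    have hk := hkpos δ hδ
    have hδ2 : δ < 1 := by linarith
    refine ⟨h.apex hp hk, ⟨h.PhiD_pwa hk hδ, h.PhiD_cont hk hδ, ⟨h.PhiD_maps hk hδ2, ?_, ?_⟩,
      PsiD lam tau e (δ ^ 2 / (‖e‖ + 1)) δ, Co.PsiD_cont hk hδ hδ2,
      fun x _ => h.Psi_Phi hδ2 x⟩, h.lip hk, h.PhiD_far hk hδ (hke δ hδ)⟩
    · intro x _ y _ hxy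
      beta_reduce at hxy
      rw [← h.Psi_Phi (k := δ ^ 2 / (‖e‖ + 1)) hδ2 x, hxy, h.Psi_Phi hδ2 y]
    · intro y hy
      exact ⟨_, h.PsiD_maps hk hδ2 hy, h.Phi_Psi hδ hδ2 y hy⟩
  · intro ε hε
    have hden : 0 < 2 * C * ‖e‖ + ‖e‖ + 1 := by positivity
    refine ⟨min (1/2) (ε / (2 * C * ‖e‖ + ‖e‖ + 1)), by positivity, min_le_left _ _, ?_⟩
    intro δ hδ hδ2
    have h1 := lt_of_lt_of_le hδ2 (min_le_left _ _)
    have h2 := lt_of_lt_of_le hδ2 (min_le_right _ _)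
    rw [lt_div_iff₀ hden] at h2
    have h3 := hkd δ hδ h1
    have hk := hkpos δ hδ
    have hCe : 0 ≤ C * ‖e‖ := by positivity
    refine ⟨fun x _ => (h.PhiD_near hk hδ x).trans ?_, ?_⟩
    · nlinarith [mul_nonneg hδ.le hCe, mul_le_mul_of_nonneg_right h3 he]
    · filter_upwards [h.PhiD_fderiv hk hδ] with x hx _
      refine ⟨hx.1, hx.2.trans ?_⟩
      rw [← hC]
      nlinarith [mul_le_mul_of_nonneg_right h3 hCe, mul_nonneg hδ.le he]
end
end

section
/- Let n ≤ m, let R ⊂ ℝⁿ be an open n-dimensional rectangle and let u ∈ C¹(cl(R), ℝ^m). Then: (i) for every σ > 0 there exists a piecewise affine function u_σ ∈ Aff(R, ℝ^m) such that sup_{x∈R} |u(x) − u_σ(x)| + ess sup_{x∈R} |∇u(x) − ∇u_σ(x)| ≤ σ and the Clarke subdifferential satisfies ∂u_σ(x) ⊆ B_σ(∇u(x)) for every x ∈ R; (ii) if rank(∇u(x)) = n for every x ∈ cl(R) (and, in the case n = m, det ∇u(x) > 0 for every x ∈ cl(R)), then u_σ ∈ Aff*(R, ℝ^m) for all sufficiently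 small σ > 0. -/
open Filter MeasureTheory Set
open scoped ENNReal

noncomputable section

/-- The approximation property of item (i) of STATEMENT 2: `uσ` is piecewise affine on `R`,
`sup_R |u − uσ| + ess sup_R |∇u − ∇uσ| ≤ σ`, and every Clarke subgradient of `uσ` at any
point of `R` lies in the open ball of radius `σ` around `∇u(x)`. -/
def ApproxProp {n m : ℕ} (u uσ : EuclideanSpace ℝ (Fin n) → (Fin m → ℝ))
    (R : Set (EuclideanSpace ℝ (Fin n))) (σ : ℝ) : Prop :=
  PiecewiseAffineOn uσ R ∧
  (∃ C₁ C₂ : ℝ, 0 ≤ C₁ ∧ 0 ≤ C₂ ∧ C₁ + C₂ ≤ σ ∧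
    (∀ x ∈ R, vnorm (u x - uσ x) ≤ C₁) ∧
    (∀ᵐ x ∂(volume.restrict R), DifferentiableAt ℝ uσ x ∧
      mnorm (jacMat u x - jacMat uσ x) ≤ C₂)) ∧
  (∀ x ∈ R, ∀ A ∈ clarkeSubdiff uσ x, mnorm (clmMat A - jacMat u x) < σ)

abbrev EE (n : ℕ) := EuclideanSpace ℝ (Fin n)

lemma ceil_sub_eq (a s : ℝ) (hs : s ∈ Ico (0:ℝ) 1) :
    (⌈a - s⌉ : ℤ) = ⌊a⌋ + if s < Int.fract a then 1 else 0 := by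
  have h1 := Int.floor_add_fract a
  have h2 := Int.fract_nonneg a
  have h3 := Int.fract_lt_one a
  obtain ⟨h4, h5⟩ := hs
  rw [Int.ceil_eq_iff]
  split_ifs with h <;> push_cast <;> constructor <;> linarith

def Pt {n : ℕ} (h : ℝ) (x : EE n) (s : ℝ) : EE n :=
  WithLp.toLp 2 (fun i => h * (⌈x i / h - s⌉ : ℝ))

def Itp {n : ℕ} {F : Type*} [NormedAddCommGroup F] [NormedSpace ℝ F] (h : ℝ) (f : EE n → F)
    (x : EE n) : F := ∫ s in Ico (0:ℝ) 1, f (Pt h x s)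

lemma norm_le_sum {n : ℕ} (x : EE n) : ‖x‖ ≤ ∑ i, |x i| := by
  rw [EuclideanSpace.norm_eq]
  apply Real.sqrt_le_iff.2
  refine ⟨Finset.sum_nonneg fun i _ => abs_nonneg _, ?_⟩
  simpa using Finset.sum_sq_le_sq_sum_of_nonneg (s := Finset.univ) (f := fun i => |x i|) (fun i _ => abs_nonneg _)

lemma sum_le_norm {n : ℕ} (x : EE n) : ∑ i, |x i| ≤ n * ‖x‖ := by
  calc ∑ i, |x i| ≤ ∑ i : Fin n, ‖x‖ := Finset.sum_le_sum fun i _ => PiLp.norm_apply_le x i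
    _ = _ := by simp

lemma Pt_dist {n : ℕ} {h : ℝ} (hh : 0 < h) (x : EE n) {s : ℝ} (hs : s ∈ Ico (0:ℝ) 1) :
    ‖Pt h x s - x‖ ≤ n * h := by
  refine (norm_le_sum _).trans ?_
  calc _ ≤ ∑ i : Fin n, h := Finset.sum_le_sum fun i _ => ?_
    _ = _ := by simp
  obtain ⟨h4, h5⟩ := hs
  have h1 := Int.le_ceil (x i / h - s)
  have h2 := Int.ceil_lt_add_one (x i / h - s)
  have e : (Pt h x s - x) i = h * ((⌈x i / h - s⌉ : ℝ) - x i / h) := by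
    simp [Pt]; field_simp
  rw [e, abs_mul, abs_of_pos hh]
  have : |(⌈x i / h - s⌉ : ℝ) - x i / h| ≤ 1 := by rw [abs_le]; constructor <;> linarith
  nlinarith

lemma Pt_int {n : ℕ} {F : Type*} [NormedAddCommGroup F] (h : ℝ) (f : EE n → F)
    (x : EE n) : IntegrableOn (fun s => f (Pt h x s)) (Ico (0:ℝ) 1) := by
  let G : (Fin n → ℤ) → F := fun z => f (WithLp.toLp 2 (fun i => h * (z i : ℝ)))
  let c : ℝ → (Fin n → ℤ) := fun s i => ⌈x i / h - s⌉
  have hc : Measurable c := by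
    refine measurable_pi_lambda _ fun i => ?_
    exact Int.measurable_ceil.comp (measurable_const.sub measurable_id)
  have hfin : (G '' Set.Icc (fun i => ⌈x i / h - 1⌉) (fun i => ⌈x i / h⌉)).Finite :=
    (Set.finite_Icc _ _).image _
  obtain ⟨C, hC⟩ := hfin.isBounded.exists_norm_le
  have hG : StronglyMeasurable G := by
    apply StronglyMeasurable.of_discrete
  refine Measure.integrableOn_of_bounded (M := C) (by simp) ?_ ?_
  · exact (hG.comp_measurable hc).aestronglyMeasurable
  · refine (ae_restrict_iff' measurableSet_Ico).2 (Eventually.of_forall fun s hs => ?_)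
    refine hC _ ⟨c s, ⟨fun i => ?_, fun i => ?_⟩, rfl⟩
    · exact Int.ceil_le_ceil (by linarith [hs.2])
    · exact Int.ceil_le_ceil (by linarith [hs.1])

lemma int_ind (t : ℝ) (h0 : 0 ≤ t) (h1 : t ≤ 1) {F : Type*} [NormedAddCommGroup F] [NormedSpace ℝ F]
    [CompleteSpace F] (c : F) :
    IntegrableOn (fun s => if s < t then c else 0) (Ico (0:ℝ) 1) ∧
    ∫ s in Ico (0:ℝ) 1, (if s < t then c else 0) = t • c := by
  have e : (fun s => if s < t then c else 0) = (Iio t).indicator (fun _ => c) := by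
    ext s; simp [indicator]
  rw [e]
  constructor
  · apply Integrable.indicator _ measurableSet_Iio
    simp
  · rw [integral_indicator measurableSet_Iio, Measure.restrict_restrict measurableSet_Iio]
    have : Iio t ∩ Ico (0:ℝ) 1 = Ico 0 t := by
      ext s; simp only [mem_inter_iff, mem_Iio, mem_Ico]; constructor
      · rintro ⟨a, b, c⟩; exact ⟨b, a⟩
      · rintro ⟨a, b⟩; exact ⟨b, a, by linarith⟩
    rw [this]
    simp [h0]

lemma ceil_int (a : ℝ) : IntegrableOn (fun s => (⌈a - s⌉ : ℝ)) (Ico (0:ℝ) 1) ∧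
    ∫ s in Ico (0:ℝ) 1, (⌈a - s⌉ : ℝ) = a := by
  have h2 := Int.fract_nonneg a
  have h3 := Int.fract_lt_one a
  obtain ⟨i1, i2⟩ := int_ind (Int.fract a) h2 h3.le (1:ℝ)
  have e : EqOn (fun s => (⌈a - s⌉ : ℝ)) (fun s => (⌊a⌋ : ℝ) + if s < Int.fract a then (1:ℝ) else 0)
      (Ico (0:ℝ) 1) := by
    intro s hs
    simp only [ceil_sub_eq a s hs]
    push_cast; rfl
  have ic : IntegrableOn (fun _ : ℝ => (⌊a⌋ : ℝ)) (Ico (0:ℝ) 1) := by simp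
  constructor
  · exact (ic.add i1).congr_fun e.symm measurableSet_Ico
  · rw [setIntegral_congr_fun measurableSet_Ico e, integral_add ic i1, i2]
    simp

lemma ceil_abs (a b : ℝ) : ∫ s in Ico (0:ℝ) 1, |(⌈a - s⌉ : ℝ) - ⌈b - s⌉| = |a - b| := by
  wlog hab : b ≤ a generalizing a b
  · rw [abs_sub_comm a b, ← this b a (by linarith)]
    exact integral_congr_ae (Eventually.of_forall fun s => abs_sub_comm _ _)
  have : ∀ s : ℝ, |(⌈a - s⌉ : ℝ) - ⌈b - s⌉| = (⌈a - s⌉ : ℝ) - ⌈b - s⌉ := fun s => by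
    apply abs_of_nonneg
    have : ⌈b - s⌉ ≤ ⌈a - s⌉ := Int.ceil_le_ceil (by linarith)
    have : (⌈b - s⌉ : ℝ) ≤ ⌈a - s⌉ := by exact_mod_cast this
    linarith
  simp_rw [this]
  rw [integral_sub (ceil_int a).1 (ceil_int b).1, (ceil_int a).2, (ceil_int b).2, abs_of_nonneg]
  linarith

lemma Itp_lip {n : ℕ} {F : Type*} [NormedAddCommGroup F] [NormedSpace ℝ F] {h : ℝ} (hh : 0 < h)
    (g : EE n → F) (x y : EE n) (B : Set (EE n)) {K : ℝ} (hK : 0 ≤ K)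
    (hg : ∀ p ∈ B, ∀ q ∈ B, ‖g p - g q‖ ≤ K * ‖p - q‖)
    (hx : ∀ s ∈ Ico (0:ℝ) 1, Pt h x s ∈ B) (hy : ∀ s ∈ Ico (0:ℝ) 1, Pt h y s ∈ B) :
    ‖Itp h g x - Itp h g y‖ ≤ K * n * ‖x - y‖ := by
  have ib : ∀ i, IntegrableOn (fun s => |(⌈x i / h - s⌉ : ℝ) - ⌈y i / h - s⌉|) (Ico (0:ℝ) 1) :=
    fun i => ((ceil_int _).1.sub (ceil_int _).1).abs
  have ib2 : IntegrableOn (fun s => K * ∑ i, h * |(⌈x i / h - s⌉ : ℝ) - ⌈y i / h - s⌉|) (Ico (0:ℝ) 1) := by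
    refine Integrable.const_mul (integrable_finsetSum _ fun i _ => (ib i).const_mul h) K
  unfold Itp
  rw [← integral_sub (Pt_int h g x) (Pt_int h g y)]
  calc _ ≤ ∫ s in Ico (0:ℝ) 1, K * ∑ i, h * |(⌈x i / h - s⌉ : ℝ) - ⌈y i / h - s⌉| := by
        refine norm_integral_le_of_norm_le ib2 ?_
        refine (ae_restrict_iff' measurableSet_Ico).2 (Eventually.of_forall fun s hs => ?_)
        refine (hg _ (hx s hs) _ (hy s hs)).trans ?_
        refine mul_le_mul_of_nonneg_left ((norm_le_sum _).trans (le_of_eq ?_)) hK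
        refine Finset.sum_congr rfl fun i _ => ?_
        simp only [Pt, PiLp.sub_apply]
        rw [← mul_sub, abs_mul, abs_of_pos hh]
    _ = K * ∑ i, |(x - y) i| := by
        rw [integral_const_mul, integral_finsetSum _ fun i _ => (ib i).const_mul h]
        congr 1
        refine Finset.sum_congr rfl fun i _ => ?_
        rw [integral_const_mul, ceil_abs, ← sub_div, abs_div, abs_of_pos hh]
        simp only [PiLp.sub_apply]
        field_simp
    _ ≤ _ := by
        rw [mul_assoc]
        exact mul_le_mul_of_nonneg_left (sum_le_norm _) hK

lemma clm_eq_sum {n : ℕ} {F : Type*} [NormedAddCommGroup F] [NormedSpace ℝ F]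
    (L : EE n →L[ℝ] F) (x : EE n) : L x = ∑ i, x i • L (EuclideanSpace.single i 1) := by
  have : x = ∑ i, x i • (EuclideanSpace.single i (1:ℝ) : EE n) := by
    ext j
    simp [Finset.sum_apply, Pi.single_apply]
  conv_lhs => rw [this]
  simp

lemma Itp_lin {n : ℕ} {F : Type*} [NormedAddCommGroup F] [NormedSpace ℝ F] [CompleteSpace F]
    {h : ℝ} (hh : 0 < h) (L : EE n →L[ℝ] F) (x : EE n) : Itp h L x = L x := by
  unfold Itp
  have e : (fun s => L (Pt h x s)) =
      fun s => ∑ i, (Pt h x s) i • L (EuclideanSpace.single i 1) := funext fun s => clm_eq_sum L _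
  rw [e, clm_eq_sum L x]
  have hi : ∀ i, IntegrableOn (fun s => (Pt h x s) i • L (EuclideanSpace.single i 1)) (Ico (0:ℝ) 1) := by
    intro i
    exact Integrable.smul_const ((ceil_int _).1.const_mul h) _
  rw [integral_finsetSum _ fun i _ => hi i]
  refine Finset.sum_congr rfl fun i _ => ?_
  rw [integral_smul_const]
  simp only [Pt]
  rw [integral_const_mul, (ceil_int _).2]
  congr 1
  field_simp

lemma telescope {n : ℕ} {F : Type*} [AddCommGroup F] (t : Fin n → ℝ) (ht : Function.Injective t)
    (φ : Finset (Fin n) → F) (A : Fin n → Finset (Fin n))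
    (hA : ∀ i j, j ∈ A i ↔ t i ≤ t j) (S : Finset (Fin n)) :
    (∀ i ∈ S, ∀ j, t i ≤ t j → j ∈ S) →
    φ S = φ ∅ + ∑ i ∈ S, (φ (A i) - φ ((A i).erase i)) := by
  classical
  induction S using Finset.induction_on_min_value t with
  | empty => simp
  | insert a s ha hmin ih =>
    intro hup
    have h1 : A a = insert a s := by
      ext j
      rw [hA]
      constructor
      · intro h; exact hup a (Finset.mem_insert_self _ _) j h
      · intro h
        rcases Finset.mem_insert.1 h with rfl | h
        · exact le_rfl
        · exact hmin j h
    have h2 : ∀ i ∈ s, ∀ j, t i ≤ t j → j ∈ s := by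
      intro i hi j hij
      rcases Finset.mem_insert.1 (hup i (Finset.mem_insert_of_mem hi) j hij) with rfl | h
      · have := ht (le_antisymm hij (hmin i hi))
        subst this; exact hi
      · exact h
    rw [Finset.sum_insert ha, h1, Finset.erase_insert ha, add_left_comm, ← ih h2]
    abel

lemma Itp_formula {n : ℕ} {F : Type*} [NormedAddCommGroup F] [NormedSpace ℝ F] [CompleteSpace F]
    (h : ℝ) (f : EE n → F) (x : EE n) (z : Fin n → ℤ)
    (hz0 : ∀ i, 0 < x i / h - z i) (hz1 : ∀ i, x i / h - z i < 1)
    (ht : Function.Injective fun i => x i / h - z i) (A : Fin n → Finset (Fin n))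
    (hA : ∀ i j, j ∈ A i ↔ x i / h - z i ≤ x j / h - z j)
    (φ : Finset (Fin n) → F)
    (hφ : ∀ S, φ S = f (WithLp.toLp 2 fun i => h * ((z i : ℝ) + if i ∈ S then 1 else 0))) :
    Itp h f x = φ ∅ + ∑ i, (x i / h - z i) • (φ (A i) - φ ((A i).erase i)) := by
  have hfl : ∀ i, ⌊x i / h⌋ = z i := fun i => by
    rw [Int.floor_eq_iff]; constructor <;> linarith [hz0 i, hz1 i]
  have hfr : ∀ i, Int.fract (x i / h) = x i / h - z i := fun i => by
    rw [← hfl i]; rfl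
  have hi := fun i => int_ind (x i / h - z i) (hz0 i).le (hz1 i).le (φ (A i) - φ ((A i).erase i))
  have e : EqOn (fun s => f (Pt h x s)) (fun s => φ ∅ + ∑ i,
      if s < x i / h - z i then (φ (A i) - φ ((A i).erase i)) else 0) (Ico (0:ℝ) 1) := by
    intro s hs
    simp only
    rw [← Finset.sum_filter, ← telescope _ ht φ A hA, hφ]
    · unfold Pt
      congr 2
      ext i
      rw [ceil_sub_eq _ _ hs, hfl, hfr]
      simp
    · intro i hi j hij
      simp only [Finset.mem_filter, Finset.mem_univ, true_and] at hi ⊢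
      linarith
  unfold Itp
  rw [setIntegral_congr_fun measurableSet_Ico e, integral_add (by simp)
    (integrable_finsetSum _ fun i _ => (hi i).1), integral_finsetSum _ fun i _ => (hi i).1]
  simp only [(hi _).2]
  simp

lemma null_hyper {n : ℕ} (L : EE n →L[ℝ] ℝ) (hL : L ≠ 0) (c : ℝ) :
    volume {x : EE n | L x = c} = 0 := by
  by_cases hne : ∃ p, L p = c
  · obtain ⟨p, hp⟩ := hne
    have := Measure.addHaar_affineSubspace (volume : Measure (EE n))
      (AffineSubspace.mk' p (LinearMap.ker (L : EE n →ₗ[ℝ] ℝ))) ?_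
    · convert this using 2
      ext x
      simp [AffineSubspace.mem_mk', hp, sub_eq_zero]
    · intro h
      apply hL
      ext v
      have : v +ᵥ p ∈ AffineSubspace.mk' p (LinearMap.ker (L : EE n →ₗ[ℝ] ℝ)) := by
        rw [h]; trivial
      simpa [AffineSubspace.mem_mk'] using this
  · have : {x : EE n | L x = c} = ∅ := by
      ext x; simp; intro h; exact hne ⟨x, h⟩
    simp [this]

lemma Itp_pw {n : ℕ} {F : Type*} [NormedAddCommGroup F] [NormedSpace ℝ F] [CompleteSpace F]
    {h : ℝ} (hh : 0 < h) (f : EE n → F) (R : Set (EE n)) (hRo : IsOpen R) (a b : Fin n → ℝ)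
    (hR : ∀ x ∈ R, ∀ i, x i ∈ Ioo (a i) (b i)) (hc : ContinuousOn (Itp h f) R) :
    PiecewiseAffineOn (Itp h f) R := by
  classical
  refine ⟨hc, ?_⟩
  let Z := Finset.Icc (fun i => ⌊a i / h⌋ : Fin n → ℤ) (fun i => ⌊b i / h⌋)
  let ι := Z × (Fin n → Fin n → Bool)
  let t : EE n → (Fin n → ℤ) → Fin n → ℝ := fun x z i => x i / h - z i
  let V : ι → Set (EE n) := fun q => R ∩ {x | (∀ i, 0 < t x q.1 i) ∧ (∀ i, t x q.1 i < 1) ∧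
    ∀ i j, (q.2 i j = true ∧ t x q.1 i < t x q.1 j) ∨ (q.2 i j = false ∧ t x q.1 j < t x q.1 i) ∨
      (q.2 i j = false ∧ i = j)}
  have htc : ∀ z i, Continuous fun x => t x z i := fun z i => by
    simp only [t]
    fun_prop
  have hfl : ∀ q x, x ∈ V q → ∀ i, ⌊x i / h⌋ = (q.1 : Fin n → ℤ) i := by
    rintro q x ⟨-, h0, h1, -⟩ i
    have := h0 i
    have := h1 i
    simp only [t] at *
    rw [Int.floor_eq_iff]; constructor <;> linarith
  have hq2 : ∀ q x, x ∈ V q → ∀ i j, q.2 i j = decide (t x q.1 i < t x q.1 j) := by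
    rintro q x ⟨-, -, -, h2⟩ i j
    rcases h2 i j with ⟨h, h'⟩ | ⟨h, h'⟩ | ⟨h, h'⟩
    · simp [h, h']
    · simp [h, h'.le]
    · subst h'; simp [h]
  let e := Fintype.equivFin ι
  refine ⟨Fintype.card ι, fun k => V (e.symm k), ?_, ?_, ?_, ?_, ?_⟩
  · intro k
    generalize e.symm k = q
    refine hRo.inter ?_
    simp only [ofPred_and, ofPred_forall]
    refine (isOpen_iInter_of_finite fun i => isOpen_lt continuous_const (htc _ i)).inter
      ((isOpen_iInter_of_finite fun i => isOpen_lt (htc _ i) continuous_const).inter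
      (isOpen_iInter_of_finite fun i => isOpen_iInter_of_finite fun j => ?_))
    simp only [ofPred_or, ofPred_and]
    refine (isOpen_const.inter (isOpen_lt (htc _ i) (htc _ j))).union
      ((isOpen_const.inter (isOpen_lt (htc _ j) (htc _ i))).union
      (isOpen_const.inter isOpen_const))
  · intro k; exact inter_subset_left
  · intro k l hkl
    rw [Set.disjoint_left]
    intro x hx hy
    apply hkl
    apply e.symm.injective
    have h1 : (e.symm k).1 = (e.symm l).1 := by
      ext i; rw [← hfl _ _ hx, ← hfl _ _ hy]
    refine Prod.ext h1 ?_
    ext i j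
    rw [hq2 _ _ hx, hq2 _ _ hy, h1]
  · let L : Fin n → EE n →L[ℝ] ℝ := fun i => EuclideanSpace.proj i
    have hsub : R \ ⋃ k, V (e.symm k) ⊆ (⋃ i : Fin n, ⋃ k : ℤ, {x | L i x = h * k}) ∪
        ⋃ i : Fin n, ⋃ j : Fin n, ⋃ _ : i ≠ j, ⋃ k : ℤ, {x | (L i - L j) x = h * k} := by
      rintro x ⟨hxR, hx⟩
      by_contra hcon
      apply hx
      simp only [mem_union, mem_iUnion, mem_ofPred_eq, not_or, not_exists] at hcon
      obtain ⟨c1, c2⟩ := hcon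
      let z : Fin n → ℤ := fun i => ⌊x i / h⌋
      have hz : z ∈ Z := by
        simp only [Z, Finset.mem_Icc]
        constructor
        · intro i; apply Int.floor_le_floor; have := (hR x hxR i).1; gcongr
        · intro i; apply Int.floor_le_floor; have := (hR x hxR i).2; gcongr
      rw [mem_iUnion]
      refine ⟨e (⟨z, hz⟩, fun i j => decide (t x z i < t x z j)), ?_⟩
      rw [Equiv.symm_apply_apply]
      refine ⟨hxR, fun i => ?_, fun i => ?_, fun i j => ?_⟩
      · refine lt_of_le_of_ne (Int.fract_nonneg (x i / h)) fun h0 => c1 i (z i) ?_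
        simp only [t, z, L] at h0 ⊢
        have : x i / h = ⌊x i / h⌋ := by linarith
        rw [← this]; simp; field_simp
      · exact Int.fract_lt_one (x i / h)
      · by_cases hij : i = j
        · subst hij; simp
        · have hne : t x z i ≠ t x z j := by
            intro h0
            apply c2 i j hij (z i - z j)
            simp only [t] at h0
            have : x i / h - x j / h = z i - z j := by linarith
            push_cast
            rw [← this]
            simp [L]; field_simp
          rcases lt_or_gt_of_ne hne with h1 | h1
          · left; simp [h1]
          · right; left; simp [h1, h1.le]
    refine measure_mono_null hsub ?_
    rw [measure_union_null_iff]
    have hL : ∀ i j, L i (EuclideanSpace.single j 1) = if i = j then 1 else 0 := by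
      intro i j; simp [L, Pi.single_apply]
    simp only [measure_iUnion_null_iff]
    constructor
    · intro i k
      apply null_hyper
      intro h0
      have := hL i i
      simp [h0] at this
    · intro i j hij k
      apply null_hyper
      intro h0
      have := congrArg (fun M : EE n →L[ℝ] ℝ => M (EuclideanSpace.single i 1)) h0
      simp [hL, hij.symm] at this
  · refine fun k => (?_ : ∀ q : ι, ∃ (L : EE n →L[ℝ] F) (c : F), ∀ x ∈ V q,
      Itp h f x = L x + c) (e.symm k)
    intro q
    let A : Fin n → Finset (Fin n) := fun i => Finset.univ.filter fun j => j = i ∨ q.2 i j = true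
    let φ : Finset (Fin n) → F := fun S =>
      f (WithLp.toLp 2 fun i => h * (((q.1 : Fin n → ℤ) i : ℝ) + if i ∈ S then 1 else 0))
    let w : Fin n → F := fun i => φ (A i) - φ ((A i).erase i)
    refine ⟨∑ i, (h⁻¹ • (EuclideanSpace.proj i : EE n →L[ℝ] ℝ)).smulRight (w i),
      φ ∅ - ∑ i, ((q.1 : Fin n → ℤ) i : ℝ) • w i, fun x hx => ?_⟩
    obtain ⟨-, h0, h1, h2⟩ := id hx
    have hinj : Function.Injective (t x q.1) := by
      intro i j hij
      rcases h2 i j with ⟨_, h'⟩ | ⟨_, h'⟩ | ⟨_, h'⟩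
      · exact absurd hij h'.ne
      · exact absurd hij h'.ne'
      · exact h'
    rw [Itp_formula h f x q.1 h0 h1 hinj A ?_ φ fun _ => rfl]
    · have hpr : ∀ i, (EuclideanSpace.proj i : EE n →L[ℝ] ℝ) x = x i := fun _ => rfl
      simp only [sum_apply, ContinuousLinearMap.smulRight_apply,
        smul_apply, sub_smul, Finset.sum_sub_distrib]
      simp only [w, smul_eq_mul, hpr, div_eq_inv_mul]
      abel
    · intro i j
      simp only [A, Finset.mem_filter, Finset.mem_univ, true_and, hq2 q x hx, decide_eq_true_eq]
      constructor
      · rintro (rfl | h')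
        · exact le_rfl
        · exact h'.le
      · intro h'
        rcases h'.lt_or_eq with h' | h'
        · exact Or.inr h'
        · exact Or.inl (hinj h'.symm)

lemma approx {n m : ℕ} (R U : Set (EE n)) (a b : Fin n → ℝ)
    (hRo : IsOpen R) (hRb : IsCompact (closure R))
    (hR : ∀ x ∈ R, ∀ i, x i ∈ Ioo (a i) (b i))
    (hU : IsOpen U) (hRU : closure R ⊆ U)
    (u : EE n → (Fin m → ℝ)) (hu : ContDiffOn ℝ 1 u U) (ε : ℝ) (hε : 0 < ε) :
    ∃ v : EE n → (Fin m → ℝ), PiecewiseAffineOn v R ∧ (∀ x ∈ R, ‖u x - v x‖ ≤ ε) ∧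
      ∀ x ∈ R, DifferentiableAt ℝ v x → ‖fderiv ℝ v x - fderiv ℝ u x‖ ≤ ε := by
  let ε' := ε / (n + 1)
  have hn : (0:ℝ) ≤ n := Nat.cast_nonneg n
  have hε' : 0 < ε' := by positivity
  have hε'n : ε' * n ≤ ε := by
    simp only [ε']; rw [div_mul_eq_mul_div, div_le_iff₀ (by positivity)]; nlinarith
  have hfc := hu.continuousOn_fderiv_of_isOpen hU le_rfl
  have k1 := hRb.uniformContinuousAt_of_continuousAt (fderiv ℝ u)
    (fun x hx => hfc.continuousAt (hU.mem_nhds (hRU hx))) (Metric.dist_mem_uniformity hε')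
  have k2 := hRb.uniformContinuousAt_of_continuousAt u
    (fun x hx => hu.continuousOn.continuousAt (hU.mem_nhds (hRU hx))) (Metric.dist_mem_uniformity hε)
  obtain ⟨δ1, hδ1, k1⟩ := Metric.mem_uniformity_dist.1 k1
  obtain ⟨δ2, hδ2, k2⟩ := Metric.mem_uniformity_dist.1 k2
  obtain ⟨δ3, hδ3, k3⟩ := hRb.exists_thickening_subset_open hU hRU
  let δ := min δ1 (min δ2 δ3)
  have hδ : 0 < δ := by positivity
  let h := δ / (2 * (n + 1))
  have hh : 0 < h := by positivity
  have hnh : n * h < δ / 2 := by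
    simp only [h]; rw [mul_div_assoc', div_lt_div_iff₀ (by positivity) (by positivity)]; nlinarith
  have hb : ∀ x0 ∈ R, ∀ y ∈ Metric.ball x0 δ, y ∈ U ∧ ‖fderiv ℝ u y - fderiv ℝ u x0‖ ≤ ε' ∧
      ‖u y - u x0‖ ≤ ε := by
    intro x0 hx0 y hy
    rw [Metric.mem_ball] at hy
    have hx0' := subset_closure hx0
    refine ⟨k3 (Metric.mem_thickening_iff.2 ⟨x0, hx0', hy.trans_le ?_⟩), ?_, ?_⟩
    · exact (min_le_right _ _).trans (min_le_right _ _)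
    · rw [dist_comm] at hy
      have := k1 (hy.trans_le (min_le_left _ _)) hx0'
      rw [← dist_eq_norm, dist_comm]; exact le_of_lt this
    · rw [dist_comm] at hy
      have := k2 (hy.trans_le ((min_le_right _ _).trans (min_le_left _ _))) hx0'
      rw [← dist_eq_norm, dist_comm]; exact le_of_lt this
  have hPt : ∀ x0 : EE n, ∀ x ∈ Metric.ball x0 (δ / 2), ∀ s ∈ Ico (0:ℝ) 1,
      Pt h x s ∈ Metric.ball x0 δ := by
    intro x0 x hx s hs
    rw [Metric.mem_ball] at hx ⊢
    have := Pt_dist hh x hs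
    rw [← dist_eq_norm] at this
    linarith [dist_triangle (Pt h x s) x x0]
  have hloc : ∀ x0 ∈ R, ∀ x ∈ Metric.ball x0 (δ / 2), ∀ y ∈ Metric.ball x0 (δ / 2),
      ‖(Itp h u x - fderiv ℝ u x0 x) - (Itp h u y - fderiv ℝ u x0 y)‖ ≤ ε * ‖x - y‖ := by
    intro x0 hx0 x hx y hy
    have e : ∀ x, Itp h u x - fderiv ℝ u x0 x = Itp h (fun p => u p - fderiv ℝ u x0 p) x := by
      intro x
      conv_lhs => rw [← Itp_lin hh (fderiv ℝ u x0) x]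
      unfold Itp
      rw [integral_sub (Pt_int h u x) (Pt_int h (fderiv ℝ u x0) x)]
    rw [e, e]
    refine (Itp_lip hh _ x y (Metric.ball x0 δ) hε'.le ?_ (hPt x0 x hx) (hPt x0 y hy)).trans
      (mul_le_mul_of_nonneg_right hε'n (norm_nonneg _))
    intro p hp q hq
    have := Convex.norm_image_sub_le_of_norm_fderiv_le' (𝕜 := ℝ) (f := u) (C := ε')
      (s := Metric.ball x0 δ) (φ := fderiv ℝ u x0) (x := q) (y := p)
      (fun z hz => (hu.differentiableOn one_ne_zero).differentiableAt
        (hU.mem_nhds (hb x0 hx0 z hz).1))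
      (fun z hz => (hb x0 hx0 z hz).2.1) (convex_ball _ _) hq hp
    rw [map_sub] at this
    convert this using 2
    abel
  have hev : ∀ x0 ∈ R, ∀ᶠ x in nhds x0, ‖(Itp h u x - fderiv ℝ u x0 x) -
      (Itp h u x0 - fderiv ℝ u x0 x0)‖ ≤ ε * ‖x - x0‖ := by
    intro x0 hx0
    filter_upwards [Metric.ball_mem_nhds x0 (half_pos hδ)] with x hx
    exact hloc x0 hx0 x hx x0 (Metric.mem_ball_self (half_pos hδ))
  refine ⟨Itp h u, Itp_pw hh u R hRo a b hR ?_, ?_, ?_⟩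
  · intro x0 hx0
    apply ContinuousAt.continuousWithinAt
    have h1 : ContinuousAt (fun x => Itp h u x - fderiv ℝ u x0 x) x0 := by
      rw [ContinuousAt, tendsto_iff_norm_sub_tendsto_zero]
      refine squeeze_zero' (Eventually.of_forall fun _ => norm_nonneg _) (hev x0 hx0) ?_
      have : Continuous fun x => ε * ‖x - x0‖ := by fun_prop
      simpa using this.tendsto x0
    have h2 := h1.add (fderiv ℝ u x0).continuous.continuousAt (x := x0)
    refine h2.congr (Eventually.of_forall fun x => ?_)
    simp
  · intro x hx
    have : u x = ∫ s in Ico (0:ℝ) 1, u x := by simp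
    unfold Itp
    rw [norm_sub_rev]
    conv_lhs => rw [this]
    rw [← integral_sub (Pt_int h u x) (by simp)]
    refine (norm_setIntegral_le_of_norm_le_const (C := ε) (by simp) fun s hs => ?_).trans (by simp)
    exact (hb x hx _ (hPt x x (Metric.mem_ball_self (half_pos hδ)) s hs)).2.2
  · intro x hx hd
    exact (hd.hasFDerivAt.sub (fderiv ℝ u x).hasFDerivAt).le_of_lip' hε.le (hev x hx)

lemma clarke_sub {n m : ℕ} (R U : Set (EE n)) (hRo : IsOpen R) 
    (hU : IsOpen U) (hRU : closure R ⊆ U)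
    (u v : EE n → (Fin m → ℝ)) (hu : ContDiffOn ℝ 1 u U) (ε : ℝ) 
    (hv : ∀ x ∈ R, DifferentiableAt ℝ v x → ‖fderiv ℝ v x - fderiv ℝ u x‖ ≤ ε)
    (x : EE n) (hx : x ∈ R) : ∀ A ∈ clarkeSubdiff v x, ‖A - fderiv ℝ u x‖ ≤ ε := by
  have hfc := hu.continuousOn_fderiv_of_isOpen hU le_rfl
  have hsub : clarkeSubdiff v x ⊆ Metric.closedBall (fderiv ℝ u x) ε := by
    refine convexHull_min ?_ (convex_closedBall _ _)
    rintro A ⟨w, hw, hd, hA⟩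
    rw [mem_closedBall_iff_norm]
    have h1 := ((hfc.continuousAt (hU.mem_nhds (hRU (subset_closure hx)))).tendsto.comp hw)
    refine le_of_tendsto (hA.sub h1).norm ?_
    filter_upwards [hw.eventually (hRo.mem_nhds hx)] with k hk
    exact hv _ hk (hd k)
  intro A hA
  exact mem_closedBall_iff_norm.1 (hsub hA)

lemma pw_diff {n m : ℕ} (R : Set (EE n)) (hRo : IsOpen R) (v : EE n → (Fin m → ℝ))
    (hv : PiecewiseAffineOn v R) : ∀ᵐ x ∂(volume.restrict R), DifferentiableAt ℝ v x := by
  obtain ⟨-, N, V, hVo, -, -, h0, hV⟩ := hv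
  rw [ae_restrict_iff' hRo.measurableSet, ae_iff]
  refine measure_mono_null (fun x hx => ?_) h0
  simp only [mem_ofPred_eq, Classical.not_imp] at hx
  refine ⟨hx.1, fun hx2 => hx.2 ?_⟩
  obtain ⟨i, hi⟩ := mem_iUnion.1 hx2
  obtain ⟨L, c, hL⟩ := hV i
  have : DifferentiableAt ℝ (fun y => L y + c) x := (L.differentiableAt).add_const c
  refine this.congr_of_eventuallyEq ?_
  filter_upwards [(hVo i).mem_nhds hi] with y hy using hL y hy

lemma vnorm_le {k : ℕ} (x : Fin k → ℝ) : vnorm x ≤ k * ‖x‖ := by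
  unfold vnorm
  apply Real.sqrt_le_iff.2
  refine ⟨by positivity, ?_⟩
  calc ∑ i, x i ^ 2 = ∑ i, |x i| ^ 2 := by simp
    _ ≤ (∑ i, |x i|) ^ 2 := Finset.sum_sq_le_sq_sum_of_nonneg (fun i _ => abs_nonneg _)
    _ ≤ (∑ i : Fin k, ‖x‖) ^ 2 := by
        gcongr with i; exact norm_le_pi_norm x i
    _ = _ := by simp

lemma clmMat_sub {n m : ℕ} (A B : EE n →L[ℝ] (Fin m → ℝ)) :
    clmMat A - clmMat B = clmMat (A - B) := by
  ext i j; simp [clmMat]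

lemma mnorm_le {n m : ℕ} (A : EE n →L[ℝ] (Fin m → ℝ)) : mnorm (clmMat A) ≤ (m * n) * ‖A‖ := by
  unfold mnorm
  apply Real.sqrt_le_iff.2
  refine ⟨by positivity, ?_⟩
  have hb : ∀ i j, |clmMat A i j| ≤ ‖A‖ := by
    intro i j
    refine (norm_le_pi_norm (A (EuclideanSpace.single j 1)) i).trans ?_
    simpa using A.le_opNorm (EuclideanSpace.single j 1)
  rw [← Finset.sum_product']
  calc ∑ p ∈ Finset.univ ×ˢ Finset.univ, clmMat A p.1 p.2 ^ 2
      = ∑ p ∈ Finset.univ ×ˢ Finset.univ, |clmMat A p.1 p.2| ^ 2 := by simp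
    _ ≤ (∑ p ∈ Finset.univ ×ˢ Finset.univ, |clmMat A p.1 p.2|) ^ 2 :=
        Finset.sum_sq_le_sq_sum_of_nonneg (fun i _ => abs_nonneg _)
    _ ≤ (∑ p ∈ (Finset.univ : Finset (Fin m)) ×ˢ (Finset.univ : Finset (Fin n)), ‖A‖) ^ 2 := by
        gcongr with i; exact hb _ _
    _ = _ := by simp

lemma clmMat_cont {n m : ℕ} :
    Continuous (clmMat : (EE n →L[ℝ] (Fin m → ℝ)) → Matrix (Fin m) (Fin n) ℝ) := by
  refine continuous_matrix fun i j => ?_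
  simp only [clmMat, Matrix.of_apply]
  fun_prop

/-- combined approximation -/
lemma approx2 {n m : ℕ} (R U : Set (EE n)) (a b : Fin n → ℝ)
    (hRo : IsOpen R) (hRb : IsCompact (closure R))
    (hR : ∀ x ∈ R, ∀ i, x i ∈ Ioo (a i) (b i))
    (hU : IsOpen U) (hRU : closure R ⊆ U)
    (u : EE n → (Fin m → ℝ)) (hu : ContDiffOn ℝ 1 u U) (σ δ : ℝ) (hσ : 0 < σ) (hδ : 0 < δ) :
    ∃ v : EE n → (Fin m → ℝ), ApproxProp u v R σ ∧
      (∀ᵐ x ∂(volume.restrict R), DifferentiableAt ℝ v x ∧ ‖fderiv ℝ v x - fderiv ℝ u x‖ ≤ δ) ∧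
      ∀ x ∈ R, ∀ A ∈ clarkeSubdiff v x, ‖A - fderiv ℝ u x‖ ≤ δ := by
  let M : ℝ := m + m * n + 1
  have hM : 0 < M := by positivity
  let ε := min δ (σ / (2 * M))
  have hε : 0 < ε := by positivity
  have hεδ : ε ≤ δ := min_le_left _ _
  have hεM : M * ε ≤ σ / 2 := by
    calc M * ε ≤ M * (σ / (2 * M)) := by gcongr; exact min_le_right _ _
      _ = _ := by field_simp
  obtain ⟨v, v1, v2, v3⟩ := approx R U a b hRo hRb hR hU hRU u hu ε hε
  have v4 := clarke_sub R U hRo hU hRU u v hu ε v3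
  have v5 := pw_diff R hRo v v1
  have v6 : ∀ᵐ x ∂(volume.restrict R), x ∈ R := ae_restrict_mem hRo.measurableSet
  have hmn : (0:ℝ) ≤ m * n := by positivity
  have hm : (0:ℝ) ≤ m := by positivity
  refine ⟨v, ⟨v1, ⟨σ / 2, σ / 2, by positivity, by positivity, by linarith, ?_, ?_⟩, ?_⟩, ?_, ?_⟩
  · intro x hx
    refine (vnorm_le _).trans (le_trans ?_ hεM)
    calc (m:ℝ) * ‖u x - v x‖ ≤ m * ε := by gcongr; exact v2 x hx
      _ ≤ M * ε := by gcongr; simp only [M]; linarith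
  · filter_upwards [v5, v6] with x hd hx
    refine ⟨hd, ?_⟩
    unfold jacMat
    rw [clmMat_sub]
    refine (mnorm_le _).trans (le_trans ?_ hεM)
    rw [norm_sub_rev]
    calc (m * n : ℝ) * ‖fderiv ℝ v x - fderiv ℝ u x‖ ≤ m * n * ε := by gcongr; exact v3 x hx hd
      _ ≤ M * ε := by gcongr; simp only [M]; linarith
  · intro x hx A hA
    unfold jacMat
    rw [clmMat_sub]
    refine ((mnorm_le _).trans (le_trans ?_ hεM)).trans_lt (by linarith)
    calc (m * n : ℝ) * ‖A - fderiv ℝ u x‖ ≤ m * n * ε := by gcongr; exact v4 x hx A hA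
      _ ≤ M * ε := by gcongr; simp only [M]; linarith
  · filter_upwards [v5, v6] with x hd hx
    exact ⟨hd, (v3 x hx hd).trans hεδ⟩
  · intro x hx A hA
    exact (v4 x hx A hA).trans hεδ

lemma pos_nbhd {n m : ℕ} (K : Set (EE n)) (hK : IsCompact K) (u : EE n → (Fin m → ℝ))
    (hc : ContinuousOn (fderiv ℝ u) K) (D : (EE n →L[ℝ] (Fin m → ℝ)) → ℝ) (hD : Continuous D)
    (hpos : ∀ x ∈ K, 0 < D (fderiv ℝ u x)) :
    ∃ η > 0, ∃ δ > 0, ∀ x ∈ K, ∀ A, ‖A - fderiv ℝ u x‖ ≤ δ → η ≤ D A := by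
  have hK' := hK.image_of_continuousOn hc
  obtain ⟨η, hη, h1⟩ := hK'.exists_forall_le' hD.continuousOn (a := 0) (by
    rintro _ ⟨x, hx, rfl⟩; exact hpos x hx)
  obtain ⟨δ, hδ, h2⟩ := hK'.exists_cthickening_subset_open
    (isOpen_lt (continuous_const (y := η / 2)) hD) (fun A hA => by
      have := h1 A hA
      simp only [mem_ofPred_eq]; linarith)
  refine ⟨η / 2, by positivity, δ, hδ, fun x hx A hA => ?_⟩
  have : A ∈ Metric.cthickening δ (fderiv ℝ u '' K) :=
    Metric.mem_cthickening_of_dist_le _ _ _ _ ⟨x, hx, rfl⟩ (by rwa [dist_eq_norm])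
  exact le_of_lt (h2 this)

/-- approximation of C¹ maps on a rectangle by piecewise affine maps with
control of the Clarke subdifferential; under a maximal-rank (and, if `n = m`, positive
determinant) assumption, the approximants can be taken in `Aff*`. -/
theorem stmt2 {n m : ℕ} (hnm : n ≤ m) (R U : Set (EuclideanSpace ℝ (Fin n)))
    (hR : ∃ a b : Fin n → ℝ, (∀ i, a i < b i) ∧
      R = {x : EuclideanSpace ℝ (Fin n) | ∀ i, x i ∈ Set.Ioo (a i) (b i)})
    (hU : IsOpen U) (hRU : closure R ⊆ U)
    (u : EuclideanSpace ℝ (Fin n) → (Fin m → ℝ)) (hu : ContDiffOn ℝ 1 u U) :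
    -- (i)
    (∀ σ > (0:ℝ), ∃ uσ, ApproxProp u uσ R σ) ∧
    -- (ii)
    ((∀ x ∈ closure R, (jacMat u x).rank = n) →
     (∀ h : n = m, ∀ x ∈ closure R, 0 < ((jacMat u x).submatrix (finCongr h) id).det) →
     ∃ σ₀ > (0:ℝ), ∀ σ, 0 < σ → σ < σ₀ →
       ∃ uσ, ApproxProp u uσ R σ ∧ AffStar uσ R) := by
  classical
  obtain ⟨a, b, hab, hReq⟩ := hR
  have hRm : ∀ x ∈ R, ∀ i, x i ∈ Ioo (a i) (b i) := by rw [hReq]; exact fun x hx => hx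
  have hRo : IsOpen R := by
    rw [hReq, ofPred_forall]
    refine isOpen_iInter_of_finite fun i => ?_
    exact isOpen_Ioo.preimage (by fun_prop : Continuous fun x : EuclideanSpace ℝ (Fin n) => x i)
  have hRb : IsCompact (closure R) := by
    apply Bornology.IsBounded.isCompact_closure
    refine isBounded_iff_forall_norm_le.2 ⟨∑ i, (|a i| + |b i|), fun x hx => ?_⟩
    refine (norm_le_sum x).trans (Finset.sum_le_sum fun i _ => ?_)
    have := hRm x hx i
    rw [abs_le]
    constructor <;> linarith [this.1, this.2, neg_abs_le (a i), le_abs_self (b i),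
      abs_nonneg (a i), abs_nonneg (b i)]
  have hfc : ContinuousOn (fderiv ℝ u) (closure R) :=
    (hu.continuousOn_fderiv_of_isOpen hU le_rfl).mono hRU
  refine ⟨fun σ hσ => ?_, fun hrank hdet => ⟨1, one_pos, fun σ hσ _ => ?_⟩⟩
  · obtain ⟨v, hv, -⟩ := approx2 R U a b hRo hRb hRm hU hRU u hu σ 1 hσ one_pos
    exact ⟨v, hv⟩
  · rcases hnm.lt_or_eq with hlt | heq
    · obtain ⟨η, hη, δ, hδ, hD⟩ := pos_nbhd (closure R) hRb u hfc
        (fun A => ((clmMat A).transpose * clmMat A).det)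
        (Continuous.matrix_det (clmMat_cont.matrix_transpose.matrix_mul clmMat_cont)) (by
          intro x hx
          have hr := hrank x hx
          have hps : (((jacMat u x).transpose * jacMat u x)).PosSemidef := by
            have := Matrix.posSemidef_conjTranspose_mul_self (jacMat u x)
            rwa [Matrix.conjTranspose_eq_transpose_of_trivial] at this
          refine lt_of_le_of_ne hps.det_nonneg fun h0 => ?_
          rw [← Matrix.rank_transpose_mul_self] at hr
          have : IsUnit ((jacMat u x).transpose * jacMat u x) := by
            rw [← Matrix.mulVec_surjective_iff_isUnit]
            have htop := Submodule.eq_top_of_finrank_eq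
              (S := LinearMap.range ((jacMat u x).transpose * jacMat u x).mulVecLin)
              (by rw [Module.finrank_fin_fun]; exact hr)
            exact LinearMap.range_eq_top.1 htop
          rw [Matrix.isUnit_iff_isUnit_det, isUnit_iff_ne_zero] at this
          exact this h0.symm)
      obtain ⟨v, hv, -, hv2⟩ := approx2 R U a b hRo hRb hRm hU hRU u hu σ δ hσ hδ
      exact ⟨v, hv, hv.1, Or.inl ⟨hlt, η, hη, fun x hx A hA =>
        hD x (subset_closure hx) A (hv2 x hx A hA)⟩⟩
    · obtain ⟨η, hη, δ, hδ, hD⟩ := pos_nbhd (closure R) hRb u hfc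
        (fun A => ((clmMat A).submatrix (finCongr heq) id).det)
        (Continuous.matrix_det (clmMat_cont.matrix_submatrix _ _)) (hdet heq)
      obtain ⟨v, hv, hv1, -⟩ := approx2 R U a b hRo hRb hRm hU hRU u hu σ δ hσ hδ
      refine ⟨v, hv, hv.1, Or.inr ⟨heq, ?_⟩⟩
      filter_upwards [hv1, ae_restrict_mem hRo.measurableSet] with x hx hxR
      exact ⟨hx.1, hη.trans_le (hD x (subset_closure hxR) _ hx.2)⟩
end
end

section
/- Let n < m, let Ω ⊆ ℝⁿ be open and let v ∈ Aff*(Ω, ℝ^m). Then v is locally injective in a quantitative sense: for every x₀ ∈ Ω there exist δ > 0 and c > 0 with B_δ(x₀) ⊂ Ω such that |v(z) − v(y)| ≥ c|z − y| for every y, z ∈ B_δ(x₀). -/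
open Filter MeasureTheory Set
open scoped ENNReal

noncomputable section

theorem aux_freq {α ι : Type*} [Finite ι] {l : Filter α} {p : ι → α → Prop}
    (h : ∃ᶠ x in l, ∃ i, p i x) : ∃ i, ∃ᶠ x in l, p i x := by
  by_contra hc
  push Not at hc
  apply h
  have := Filter.eventually_all.2 hc
  filter_upwards [this] with x hx
  rintro ⟨i, hi⟩
  exact hx i hi

theorem aux_line {ι : Type*} [Finite ι] (h : ℝ → ℝ) (hc : ContinuousOn h (Icc 0 1))
    (a b : ι → ℝ) (M : ℝ) (ha : ∀ i, a i ≤ M)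
    (hs : ∀ t ∈ Icc (0:ℝ) 1, ∃ i, h t = a i * t + b i) : h 1 - h 0 ≤ M := by
  have key := image_le_of_liminf_slope_right_le_deriv_boundary (f := h) (a := 0) (b := 1) hc
    (B := fun t => h 0 + M * t) (B' := fun _ => M) (by simp) (by fun_prop)
    (by
      intro x hx
      exact (((hasDerivAt_id x).const_mul M).const_add (h 0)).hasDerivWithinAt.congr_deriv
        (by simp))
    (by
      intro x hx r hr
      have hev : ∀ᶠ z in nhdsWithin x (Ioi x), z ∈ Ioc x 1 := Ioc_mem_nhdsGT hx.2
      have h1 : ∀ᶠ z in nhdsWithin x (Ioi x), ∃ i, h z = a i * z + b i := by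
        filter_upwards [hev] with z hz
        exact hs z ⟨hx.1.trans hz.1.le, hz.2⟩
      obtain ⟨i, hi⟩ := aux_freq h1.frequently
      have ht1 : Tendsto h (nhdsWithin x (Ioi x)) (nhds (h x)) := by
        apply (hc x ⟨hx.1, hx.2.le⟩).mono_left
        refine nhdsWithin_le_of_mem ?_
        filter_upwards [hev] with z hz
        exact ⟨hx.1.trans hz.1.le, hz.2⟩
      have ht2 : Tendsto (fun z => a i * z + b i) (nhdsWithin x (Ioi x)) (nhds (a i * x + b i)) := by
        have : Continuous (fun z => a i * z + b i) := by fun_prop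
        exact (this.tendsto x).mono_left nhdsWithin_le_nhds
      have hx' := tendsto_nhds_unique_of_frequently_eq ht1 ht2 hi
      refine (hi.and_eventually hev).mono ?_
      rintro z ⟨hz, hz2⟩
      have : 0 < z - x := sub_pos.2 hz2.1
      rw [slope_def_field, hz, hx', div_lt_iff₀ this]
      nlinarith [ha i])
  have := key (x := 1) (by simp)
  simp at this
  linarith

theorem aux_seg {F ι : Type*} [NormedAddCommGroup F] [NormedSpace ℝ F] [Finite ι]
    (g : ℝ → F) (hc : ContinuousOn g (Icc 0 1)) (a b : ι → F)
    (hs : ∀ t ∈ Icc (0:ℝ) 1, ∃ i, g t = t • a i + b i) :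
    g 1 - g 0 ∈ convexHull ℝ (range a) := by
  by_contra hn
  obtain ⟨f, u, hu1, hu2⟩ := geometric_hahn_banach_closed_point (convex_convexHull ℝ (range a))
    ((Set.finite_range a).isClosed_convexHull ℝ) hn
  have := aux_line (fun t => f (g t)) (f.continuous.comp_continuousOn hc)
    (fun i => f (a i)) (fun i => f (b i)) u
    (fun i => (hu1 _ (subset_convexHull ℝ _ (mem_range_self i))).le)
    (by
      intro t ht
      obtain ⟨i, hi⟩ := hs t ht
      exact ⟨i, by simp [hi, mul_comm]⟩)
  rw [map_sub] at hu2
  linarith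

theorem aux_inj {n m : ℕ} (A : EuclideanSpace ℝ (Fin n) →L[ℝ] (Fin m → ℝ))
    (hA : 0 < ((clmMat A).transpose * clmMat A).det) (u : EuclideanSpace ℝ (Fin n))
    (hu : A u = 0) : u = 0 := by
  have h1 : (clmMat A).mulVec u.ofLp = A u := by
    have : u = ∑ j, u j • EuclideanSpace.single j (1:ℝ) := by
      ext k
      simp [Finset.sum_apply, Pi.single_apply]
    ext i
    conv_rhs => rw [this]
    simp [Matrix.mulVec, dotProduct, clmMat, mul_comm]
  have h2 : ((clmMat A).transpose * clmMat A).mulVec u.ofLp = 0 := by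
    rw [← Matrix.mulVec_mulVec, h1, hu, Matrix.mulVec_zero]
  have := Matrix.eq_zero_of_mulVec_eq_zero hA.ne' h2
  ext k
  simp [this]

theorem aux_vnorm {k : ℕ} (x : Fin k → ℝ) : ‖x‖ ≤ vnorm x := by
  unfold vnorm
  rw [pi_norm_le_iff_of_nonneg (Real.sqrt_nonneg _)]
  intro i
  apply Real.le_sqrt_of_sq_le
  rw [Real.norm_eq_abs, sq_abs]
  exact Finset.single_le_sum (f := fun i => x i ^ 2) (fun j _ => sq_nonneg _) (Finset.mem_univ i)

/-- a map `v ∈ Aff*(Ω, ℝ^m)` with `n < m` is locally injective in a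
quantitative sense: around every point of `Ω` there is a ball on which
`|v z − v y| ≥ c |z − y|` for some `c > 0`. -/
theorem stmt4 {n m : ℕ} (hnm : n < m)
    (Ω : Set (EuclideanSpace ℝ (Fin n))) (hΩ : IsOpen Ω)
    (v : EuclideanSpace ℝ (Fin n) → (Fin m → ℝ))
    (hv : PiecewiseAffineOn v Ω)
    (hv' : ∃ η > (0:ℝ), ∀ x ∈ Ω, ∀ A ∈ clarkeSubdiff v x,
      η ≤ ((clmMat A).transpose * clmMat A).det) :
    ∀ x₀ ∈ Ω, ∃ δ > (0:ℝ), ∃ c > (0:ℝ), Metric.ball x₀ δ ⊆ Ω ∧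
      ∀ y ∈ Metric.ball x₀ δ, ∀ z ∈ Metric.ball x₀ δ,
        c * ‖z - y‖ ≤ vnorm (v z - v y) := by
  intro x₀ hx₀
  obtain ⟨hcont, N, V, hVo, hVs, -, hnull, haff⟩ := hv
  choose L c hL using haff
  obtain ⟨η, hη, hdet⟩ := hv'
  have hev : ∀ᶠ x in nhds x₀, x ∈ Ω ∧ ∀ i, x₀ ∉ closure (V i) → x ∉ V i := by
    refine Filter.Eventually.and (hΩ.mem_nhds hx₀) (Filter.eventually_all.2 fun i => ?_)
    by_cases hi : x₀ ∈ closure (V i)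
    · simp [hi]
    · filter_upwards [isClosed_closure.isOpen_compl.mem_nhds hi] with x hx _ hx2
      exact hx (subset_closure hx2)
  obtain ⟨δ, hδ, hball⟩ := Metric.eventually_nhds_iff_ball.1 hev
  let ι := {i : Fin N // x₀ ∈ closure (V i)}
  have hsel : ∀ x ∈ Metric.ball x₀ δ, ∃ i : ι, v x = L i x + c i := by
    intro x hx
    have hfr : ∃ᶠ x' in nhds x, ∃ i, x' ∈ Metric.ball x₀ δ ∧ x' ∈ V i := by
      intro hno
      have hb := Metric.isOpen_ball.mem_nhds hx
      have hmem : Ω \ ⋃ i, V i ∈ nhds x := by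
        filter_upwards [hno, hb] with y hy hyb
        refine ⟨(hball y hyb).1, fun hyV => ?_⟩
        obtain ⟨i, hi⟩ := mem_iUnion.1 hyV
        exact hy ⟨i, hyb, hi⟩
      exact (Measure.measure_pos_of_mem_nhds volume hmem).ne' hnull
    obtain ⟨i, hi⟩ := aux_freq hfr
    have hiI : x₀ ∈ closure (V i) := by
      obtain ⟨y, hy, hyV⟩ := hi.exists
      by_contra hcl
      exact (hball y hy).2 i hcl hyV
    refine ⟨⟨i, hiI⟩, ?_⟩
    refine tendsto_nhds_unique_of_frequently_eq
      (hcont.continuousAt (hΩ.mem_nhds (hball x hx).1))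
      (((L i).continuous.add continuous_const).tendsto x) (hi.mono ?_)
    rintro y ⟨-, hy⟩
    exact hL i y hy
  let K := convexHull ℝ (range fun i : ι => L i)
  have hKc : IsCompact K := (Set.finite_range _).isCompact_convexHull ℝ
  have hKsub : K ⊆ clarkeSubdiff v x₀ := by
    refine convexHull_mono ?_
    rintro _ ⟨⟨i, hi⟩, rfl⟩
    obtain ⟨u, hu, hux⟩ := mem_closure_iff_seq_limit.1 hi
    have hd : ∀ k, HasFDerivAt v (L i) (u k) := by
      intro k
      refine ((L i).hasFDerivAt.add_const (c i)).congr_of_eventuallyEq ?_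
      filter_upwards [(hVo i).mem_nhds (hu k)] with y hy
      exact hL i y hy
    refine ⟨u, hux, fun k => (hd k).differentiableAt, ?_⟩
    simp only [fun k => (hd k).fderiv]
    exact tendsto_const_nhds
  obtain ⟨c₀, hc₀, hbd⟩ := (hKc.prod (isCompact_sphere (0 : EuclideanSpace ℝ (Fin n)) 1)).exists_forall_le'
    (f := fun p => ‖p.1 p.2‖) (a := 0) (by fun_prop) (by
      rintro ⟨A, u⟩ ⟨hA, hu⟩
      rw [norm_pos_iff]
      intro h0
      have := aux_inj A (hη.trans_le (hdet x₀ hx₀ A (hKsub hA))) u h0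
      simp [this] at hu)
  refine ⟨δ, hδ, c₀, hc₀, fun x hx => (hball x hx).1, ?_⟩
  intro y hy z hz
  refine le_trans ?_ (aux_vnorm _)
  have hseg : ∀ t ∈ Icc (0:ℝ) 1, y + t • (z - y) ∈ Metric.ball x₀ δ := fun t ht =>
    (convex_ball x₀ δ).add_smul_sub_mem hy hz ht
  have hmem := aux_seg (fun t => v (y + t • (z - y)))
    (hcont.comp (by fun_prop) (fun t ht => (hball _ (hseg t ht)).1))
    (fun i : ι => L i (z - y)) (fun i => L i y + c i) (by
      intro t ht
      obtain ⟨i, hi⟩ := hsel _ (hseg t ht)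
      refine ⟨i, ?_⟩
      simp only [hi, map_add, map_smul]
      abel)
  have himg : convexHull ℝ (range fun i : ι => L i (z - y)) =
      (ContinuousLinearMap.apply ℝ (Fin m → ℝ) (z - y)).toLinearMap '' K := by
    rw [LinearMap.image_convexHull, ← range_comp]
    rfl
  rw [himg] at hmem
  obtain ⟨A, hA, hAe⟩ := hmem
  have hAe' : A (z - y) = v z - v y := by simpa using hAe
  rw [← hAe']
  by_cases hzy : z - y = 0
  · simp [hzy]
  have hpos : 0 < ‖z - y‖ := norm_pos_iff.2 hzy
  have := hbd (A, ‖z - y‖⁻¹ • (z - y)) ⟨hA, by simp [norm_smul, hpos.ne']⟩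
  simp only [map_smul, norm_smul, norm_inv, norm_norm] at this
  rwa [inv_mul_eq_div, le_div_iff₀ hpos] at this
end
end

section
/- Let 1 < p < ∞ and let W : M^{3×3} → [0,+∞] satisfy hypotheses (H1)–(H5). Define W₀(A) := inf_{ζ∈ℝ³} W(A|ζ) for A ∈ M^{3×2}. Then: (i) W₀ is continuous as an extended-valued function and W₀(A) ≥ C₁|A|^p − 1/C₁ for all A ∈ M^{3×2}, with the same constants C₁ and p as in (H4); (ii) for A ∈ M^{3×2}, W₀(A) = +∞ if and only if A¹ ∧ A² = 0; (iii) for every δ > 0 there exists c_δ > 0 such that for every A ∈ M^{3×2} with |A¹ ∧ A²| ≥ δ one has W₀(A) ≤ c_δ(1 + |A|^p). -/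
open Filter MeasureTheory Set
open scoped ENNReal

noncomputable section

lemma det_aug (A : Matrix (Fin 3) (Fin 2) ℝ) (ζ : Fin 3 → ℝ) :
    (aug A ζ).det = ∑ i, crossCols A i * ζ i := by
  rw [Matrix.det_fin_three, Fin.sum_univ_three]
  simp [aug, crossCols, cross3]
  ring

lemma sq_aug (A : Matrix (Fin 3) (Fin 2) ℝ) (ζ : Fin 3 → ℝ) :
    ∑ i, ∑ j, (aug A ζ) i j ^ 2 = (∑ i, ∑ j, A i j ^ 2) + ∑ i, ζ i ^ 2 := by
  simp [aug, Fin.sum_univ_three, Fin.sum_univ_two]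
  ring

lemma mnorm_le_aug (A : Matrix (Fin 3) (Fin 2) ℝ) (ζ : Fin 3 → ℝ) :
    mnorm A ≤ mnorm (aug A ζ) := by
  unfold mnorm
  apply Real.sqrt_le_sqrt
  rw [sq_aug]
  have : 0 ≤ ∑ i, ζ i ^ 2 := by positivity
  linarith

lemma norm_le_aug (A : Matrix (Fin 3) (Fin 2) ℝ) (ζ : Fin 3 → ℝ) :
    ‖ζ‖ ≤ mnorm (aug A ζ) := by
  have h0 : 0 ≤ mnorm (aug A ζ) := Real.sqrt_nonneg _
  rw [pi_norm_le_iff_of_nonneg h0]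
  intro i
  rw [Real.norm_eq_abs]
  unfold mnorm
  apply Real.abs_le_sqrt
  rw [sq_aug]
  have h1 : 0 ≤ ∑ i, ∑ j, A i j ^ 2 := by positivity
  have h2 : ζ i ^ 2 ≤ ∑ i, ζ i ^ 2 :=
    Finset.single_le_sum (f := fun i => ζ i ^ 2) (fun i _ => sq_nonneg _) (Finset.mem_univ i)
  linarith

lemma continuous_aug : Continuous (fun q : Matrix (Fin 3) (Fin 2) ℝ × (Fin 3 → ℝ) =>
    aug q.1 q.2) := by
  apply continuous_matrix
  intro i j
  unfold aug
  by_cases h : (j : ℕ) < 2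
  · simp only [Matrix.of_apply, h, dite_true]
    exact (continuous_apply_apply (ρ := fun (_ : Fin 3) (_ : Fin 2) => ℝ) i ⟨j, h⟩).comp
      continuous_fst
  · simp only [Matrix.of_apply, h, dite_false]
    fun_prop

lemma W0_cont (p C₁ : ℝ) (hp : 1 < p) (W : Matrix (Fin 3) (Fin 3) ℝ → ℝ≥0∞)
    (hW1 : Continuous W) (hC₁ : 0 < C₁)
    (hW4 : ∀ F, ENNReal.ofReal (C₁ * mnorm F ^ p - 1 / C₁) ≤ W F) :
    Continuous (W0fun W) := by
  have hc : Continuous (fun q : Matrix (Fin 3) (Fin 2) ℝ × (Fin 3 → ℝ) => W (aug q.1 q.2)) :=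
    hW1.comp continuous_aug
  rw [continuous_iff_lower_upperSemicontinuous]
  constructor
  · intro A₀ c hcA
    obtain ⟨c', h1, h2⟩ := exists_between hcA
    have ht : Tendsto (fun t : ℝ => ENNReal.ofReal (C₁ * t ^ p - 1 / C₁)) atTop (nhds ⊤) := by
      apply ENNReal.tendsto_ofReal_nhds_top.2
      apply tendsto_atTop_add_const_right
      exact (tendsto_rpow_atTop (by linarith)).const_mul_atTop hC₁
    obtain ⟨M, hM⟩ := eventually_atTop.1 (ht.eventually (lt_mem_nhds (lt_of_lt_of_le h2 le_top)))
    have hopen : IsOpen {q : Matrix (Fin 3) (Fin 2) ℝ × (Fin 3 → ℝ) | c' < W (aug q.1 q.2)} :=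
      isOpen_lt continuous_const hc
    have hK : IsCompact (Metric.closedBall (0 : Fin 3 → ℝ) M) := isCompact_closedBall _ _
    have hev : ∀ᶠ A in nhds A₀, ∀ ζ ∈ Metric.closedBall (0 : Fin 3 → ℝ) M, c' < W (aug A ζ) := by
      apply hK.eventually_forall_of_forall_eventually
      intro ζ _
      exact hopen.mem_nhds (lt_of_lt_of_le h2 (iInf_le _ ζ))
    filter_upwards [hev] with A hA
    refine lt_of_lt_of_le h1 (le_iInf fun ζ => ?_)
    by_cases hζ : ‖ζ‖ ≤ M
    · exact (hA ζ (by simpa using hζ)).le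
    · exact (hM _ ((not_le.1 hζ).le.trans (norm_le_aug A ζ))).le.trans (hW4 _)
  · unfold W0fun
    apply upperSemicontinuous_iInf
    intro ζ
    exact (hc.comp (by fun_prop : Continuous fun A => (A, ζ))).upperSemicontinuous

lemma rpow_aux (p a b : ℝ) (hp : 1 < p) (ha : 0 ≤ a) (hb : 0 ≤ b) (h : b ≤ a + 1) :
    1 + b ^ p ≤ (1 + 2 ^ p) * (1 + a ^ p) := by
  have hp0 : 0 ≤ p := by linarith
  have h2 : (0:ℝ) ≤ 2 ^ p := by positivity
  have hap : 0 ≤ a ^ p := by positivity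
  have : b ^ p ≤ 2 ^ p * (1 + a ^ p) := by
    rcases le_total a 1 with h1 | h1
    · have := Real.rpow_le_rpow hb (by linarith : b ≤ 2) hp0
      nlinarith
    · have := Real.rpow_le_rpow hb (by linarith : b ≤ 2 * a) hp0
      rw [Real.mul_rpow (by norm_num) ha] at this
      nlinarith
  nlinarith

/-- properties of the reduced density W₀. -/
theorem stmt5
    (p C₁ : ℝ) (hp : 1 < p) (W : Matrix (Fin 3) (Fin 3) ℝ → ℝ≥0∞)
    -- (H1) continuity as an extended-valued function
    (hW1 : Continuous W)
    -- (H2) frame indifference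
    (hW2 : ∀ (F R : Matrix (Fin 3) (Fin 3) ℝ), R.transpose * R = 1 → R.det = 1 →
      W (R * F) = W F)
    -- (H3)
    (hW3fin : ∀ F : Matrix (Fin 3) (Fin 3) ℝ, 0 < F.det → W F ≠ ⊤)
    (hW3inf : ∀ F : Matrix (Fin 3) (Fin 3) ℝ, F.det ≤ 0 → W F = ⊤)
    -- (H4) p-coercivity
    (hC₁ : 0 < C₁)
    (hW4 : ∀ F, ENNReal.ofReal (C₁ * mnorm F ^ p - 1 / C₁) ≤ W F)
    -- (H5) weak p-growth where the determinant is bounded away from 0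
    (hW5 : ∀ δ : ℝ, 0 < δ → ∃ c : ℝ, 0 < c ∧ ∀ F, δ ≤ F.det →
      W F ≤ ENNReal.ofReal (c * (1 + mnorm F ^ p)))
    :
    -- (i) W₀ is continuous and p-coercive with the same constants C₁ and p
    Continuous (W0fun W) ∧
    (∀ A, ENNReal.ofReal (C₁ * mnorm A ^ p - 1 / C₁) ≤ W0fun W A) ∧
    -- (ii) W₀(A) = +∞ iff A¹ ∧ A² = 0
    (∀ A, W0fun W A = ⊤ ↔ crossCols A = 0) ∧
    -- (iii) p-growth where |A¹ ∧ A²| is bounded away from 0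
    (∀ δ : ℝ, 0 < δ → ∃ c : ℝ, 0 < c ∧ ∀ A, δ ≤ vnorm (crossCols A) →
      W0fun W A ≤ ENNReal.ofReal (c * (1 + mnorm A ^ p))) := by
  refine ⟨W0_cont p C₁ hp W hW1 hC₁ hW4, ?_, ?_, ?_⟩
  · intro A
    refine le_iInf fun ζ => le_trans (ENNReal.ofReal_le_ofReal ?_) (hW4 _)
    have := Real.rpow_le_rpow (Real.sqrt_nonneg _) (mnorm_le_aug A ζ) (by linarith : 0 ≤ p)
    have := mul_le_mul_of_nonneg_left this hC₁.le
    unfold mnorm at *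
    linarith
  · intro A
    constructor
    · intro h
      by_contra hne
      have h1 := (iInf_eq_top.1 h) (crossCols A)
      refine hW3fin _ ?_ h1
      rw [det_aug]
      obtain ⟨i, hi⟩ := Function.ne_iff.1 hne
      exact Finset.sum_pos' (fun i _ => mul_self_nonneg _)
        ⟨i, Finset.mem_univ i, mul_self_pos.2 hi⟩
    · intro h
      refine iInf_eq_top.2 fun ζ => hW3inf _ ?_
      rw [det_aug, h]
      simp
  · intro δ hδ
    obtain ⟨c, hc, H⟩ := hW5 δ hδ
    refine ⟨c * (1 + 2 ^ p), by positivity, fun A hA => ?_⟩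
    set n := vnorm (crossCols A) with hn
    have hn0 : 0 < n := lt_of_lt_of_le hδ hA
    have hnn : ∑ i, crossCols A i ^ 2 = n ^ 2 := by
      rw [hn]; unfold vnorm; rw [Real.sq_sqrt (by positivity)]
    set ζ : Fin 3 → ℝ := fun i => crossCols A i / n with hζ
    have hz : ∑ i, ζ i ^ 2 = 1 := by
      simp only [hζ, div_pow, ← Finset.sum_div, hnn]
      field_simp
    have hd : (aug A ζ).det = n := by
      rw [det_aug]
      have : ∀ i, crossCols A i * ζ i = crossCols A i ^ 2 / n := fun i => by
        simp only [hζ]; ring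
      simp only [this, ← Finset.sum_div, hnn]
      field_simp
    refine (iInf_le _ ζ).trans ((H _ (by rw [hd]; exact hA)).trans (ENNReal.ofReal_le_ofReal ?_))
    rw [mul_assoc]
    refine mul_le_mul_of_nonneg_left (rpow_aux p _ _ hp (Real.sqrt_nonneg _)
      (Real.sqrt_nonneg _) ?_) hc.le
    have h0 : 0 ≤ mnorm A := Real.sqrt_nonneg _
    have h1 : mnorm A ^ 2 = ∑ i, ∑ j, A i j ^ 2 := Real.sq_sqrt (by positivity)
    change Real.sqrt (∑ i, ∑ j, (aug A ζ) i j ^ 2) ≤ mnorm A + 1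
    rw [sq_aug, hz, ← h1]
    apply Real.sqrt_le_iff.2
    constructor
    · linarith
    · nlinarith
end
end

section
/- Let 1 < p < ∞ and let W : M^{3×3} → [0,+∞] satisfy hypotheses (H1)–(H5), and let W₀(A) := inf_{ζ∈ℝ³} W(A|ζ). For α, K > 0 set Λ(α,K) := {A ∈ M^{3×2} : |A¹ ∧ A²| ≥ α, |A| ≤ K}. Then there exists β = β(α,K) > 0 such that for every A ∈ Λ(α,K), W₀(A) = min{ W(A|ζ) : ζ ∈ ℝ³, det(A|ζ) ≥ 1/β, |ζ| ≤ β }, and in particular this minimum is attained. -/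
open Filter MeasureTheory Set
open scoped ENNReal

noncomputable section

lemma mnorm_aug (A : Matrix (Fin 3) (Fin 2) ℝ) (ζ : Fin 3 → ℝ) :
    mnorm (aug A ζ) = Real.sqrt ((∑ i, ∑ j, A i j ^ 2) + ∑ i, ζ i ^ 2) := by
  unfold mnorm
  congr 1
  simp [aug, Fin.sum_univ_succ]
  ring

lemma det_aug_cross (A : Matrix (Fin 3) (Fin 2) ℝ) :
    (aug A (crossCols A)).det = ∑ i, crossCols A i ^ 2 := by
  simp [aug, Matrix.det_fin_three, Fin.sum_univ_succ, crossCols, cross3]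
  ring

lemma cross_sq_le (A : Matrix (Fin 3) (Fin 2) ℝ) :
    ∑ i, crossCols A i ^ 2 ≤ (∑ i, ∑ j, A i j ^ 2) ^ 2 := by
  simp [Fin.sum_univ_succ, crossCols, cross3]
  have h1 : 0 ≤ A 0 0 ^ 2 + A 1 0 ^ 2 + A 2 0 ^ 2 := by positivity
  have h2 : 0 ≤ A 0 1 ^ 2 + A 1 1 ^ 2 + A 2 1 ^ 2 := by positivity
  nlinarith [sq_nonneg (A 0 0 * A 0 1 + A 1 0 * A 1 1 + A 2 0 * A 2 1),
    mul_nonneg h1 h2, sq_nonneg (A 0 0 ^ 2 + A 1 0 ^ 2 + A 2 0 ^ 2),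
    sq_nonneg (A 0 1 ^ 2 + A 1 1 ^ 2 + A 2 1 ^ 2)]

lemma continuous_aug_s6 (A : Matrix (Fin 3) (Fin 2) ℝ) : Continuous (aug A) := by
  refine continuous_matrix fun i j => ?_
  by_cases h : (j : ℕ) < 2
  · simp only [aug, Matrix.of_apply, dif_pos h]
    exact continuous_const
  · simp only [aug, Matrix.of_apply, dif_neg h]
    exact continuous_apply i

lemma abs_le_mnorm {k l : ℕ} (A : Matrix (Fin k) (Fin l) ℝ) (i : Fin k) (j : Fin l) :
    |A i j| ≤ mnorm A := by
  refine Real.abs_le_sqrt ?_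
  calc A i j ^ 2 ≤ ∑ j, A i j ^ 2 :=
        Finset.single_le_sum (f := fun j => A i j ^ 2) (fun _ _ => sq_nonneg _) (Finset.mem_univ j)
    _ ≤ _ := Finset.single_le_sum (f := fun i => ∑ j, A i j ^ 2)
        (fun _ _ => Finset.sum_nonneg fun _ _ => sq_nonneg _) (Finset.mem_univ i)

lemma vnorm_le_aug (A : Matrix (Fin 3) (Fin 2) ℝ) (ζ : Fin 3 → ℝ) :
    vnorm ζ ≤ mnorm (aug A ζ) := by
  rw [mnorm_aug]
  refine Real.sqrt_le_sqrt ?_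
  have : 0 ≤ ∑ i, ∑ j, A i j ^ 2 :=
    Finset.sum_nonneg fun _ _ => Finset.sum_nonneg fun _ _ => sq_nonneg _
  linarith

/-- on the compact set Λ(α,K) the infimum defining W₀ is attained at some ζ
with |ζ| ≤ β and det(A|ζ) ≥ 1/β, for a constant β = β(α,K). -/
theorem stmt6
    (p C₁ : ℝ) (hp : 1 < p) (W : Matrix (Fin 3) (Fin 3) ℝ → ℝ≥0∞)
    -- (H1) continuity as an extended-valued function
    (hW1 : Continuous W)
    -- (H2) frame indifference
    (hW2 : ∀ (F R : Matrix (Fin 3) (Fin 3) ℝ), R.transpose * R = 1 → R.det = 1 →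
      W (R * F) = W F)
    -- (H3)
    (hW3fin : ∀ F : Matrix (Fin 3) (Fin 3) ℝ, 0 < F.det → W F ≠ ⊤)
    (hW3inf : ∀ F : Matrix (Fin 3) (Fin 3) ℝ, F.det ≤ 0 → W F = ⊤)
    -- (H4) p-coercivity
    (hC₁ : 0 < C₁)
    (hW4 : ∀ F, ENNReal.ofReal (C₁ * mnorm F ^ p - 1 / C₁) ≤ W F)
    -- (H5) weak p-growth where the determinant is bounded away from 0
    (hW5 : ∀ δ : ℝ, 0 < δ → ∃ c : ℝ, 0 < c ∧ ∀ F, δ ≤ F.det →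
      W F ≤ ENNReal.ofReal (c * (1 + mnorm F ^ p)))
    (α K : ℝ) (hα : 0 < α) (hK : 0 < K) :
    ∃ β > (0:ℝ), ∀ A : Matrix (Fin 3) (Fin 2) ℝ,
      α ≤ vnorm (crossCols A) → mnorm A ≤ K →
      -- the constrained minimum is attained and equals W₀(A)
      (∃ ζ : Fin 3 → ℝ, 1 / β ≤ (aug A ζ).det ∧ vnorm ζ ≤ β ∧ W (aug A ζ) = W0fun W A) ∧
      (∀ ζ : Fin 3 → ℝ, 1 / β ≤ (aug A ζ).det → vnorm ζ ≤ β → W0fun W A ≤ W (aug A ζ)) := by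
  obtain ⟨c, hc, hcW⟩ := hW5 (α ^ 2) (by positivity)
  set B : ℝ := Real.sqrt (K ^ 2 + (K ^ 2) ^ 2) with hB
  set M : ℝ := c * (1 + B ^ p) with hM
  have hB0 : 0 ≤ B := Real.sqrt_nonneg _
  have hM0 : 0 ≤ M := by positivity
  set R : ℝ := ((M + 1 / C₁) / C₁) ^ (1 / p) with hR
  have hp0 : 0 < p := by linarith
  have hbound : ∀ F, W F ≤ ENNReal.ofReal M → mnorm F ≤ R := by
    intro F hF
    have h1 := (hW4 F).trans hF
    rw [ENNReal.ofReal_le_ofReal_iff hM0] at h1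
    have h0 : 0 ≤ mnorm F := Real.sqrt_nonneg _
    have h2 : mnorm F ^ p ≤ (M + 1 / C₁) / C₁ := by
      rw [le_div_iff₀ hC₁]; linarith
    have h3 := Real.rpow_le_rpow (Real.rpow_nonneg h0 p) h2 (by positivity : 0 ≤ 1 / p)
    rwa [← Real.rpow_mul h0, mul_one_div_cancel hp0.ne', Real.rpow_one] at h3
  have hSc : IsClosed {F | W F ≤ ENNReal.ofReal M} := isClosed_le hW1 continuous_const
  have hS : IsCompact {F | W F ≤ ENNReal.ofReal M} := by
    have hbox : IsCompact (Set.univ.pi fun _ : Fin 3 => Set.univ.pi fun _ : Fin 3 =>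
        Set.Icc (-R) R) :=
      isCompact_univ_pi fun _ => isCompact_univ_pi fun _ => isCompact_Icc
    refine IsCompact.of_isClosed_subset hbox hSc ?_
    intro F hF i _ j _
    exact abs_le.mp ((abs_le_mnorm F i j).trans (hbound F hF))
  have hd : ∃ d > (0:ℝ), ∀ F, W F ≤ ENNReal.ofReal M → d ≤ F.det := by
    rcases Set.eq_empty_or_nonempty {F | W F ≤ ENNReal.ofReal M} with he | hne
    · refine ⟨1, one_pos, fun F hF => ?_⟩
      have : F ∈ {F | W F ≤ ENNReal.ofReal M} := hF
      rw [he] at this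
      exact this.elim
    · obtain ⟨F₀, hF₀, hmin⟩ := hS.exists_isMinOn hne
        (continuous_id.matrix_det (R := ℝ)).continuousOn
      refine ⟨F₀.det, ?_, fun F hF => hmin hF⟩
      by_contra hneg
      have h1 := hW3inf F₀ (not_lt.mp hneg)
      have h2 : W F₀ ≤ ENNReal.ofReal M := hF₀
      rw [h1] at h2
      exact ENNReal.ofReal_ne_top (top_le_iff.mp h2)
  obtain ⟨d, hd0, hd⟩ := hd
  have hβ : 0 < max R (1 / d) := lt_max_of_lt_right (by positivity)
  refine ⟨max R (1 / d), hβ, fun A hA hAK => ⟨?_, fun ζ _ _ => iInf_le _ ζ⟩⟩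
  have hA0 : 0 ≤ ∑ i, ∑ j, A i j ^ 2 :=
    Finset.sum_nonneg fun _ _ => Finset.sum_nonneg fun _ _ => sq_nonneg _
  have hAK2 : ∑ i, ∑ j, A i j ^ 2 ≤ K ^ 2 := by
    exact (Real.sqrt_le_left hK.le).mp hAK
  have hz : W (aug A (crossCols A)) ≤ ENNReal.ofReal M := by
    refine (hcW _ ?_).trans (ENNReal.ofReal_le_ofReal ?_)
    · rw [det_aug_cross]
      exact (Real.le_sqrt' hα).mp hA
    · have h1 : mnorm (aug A (crossCols A)) ≤ B := by
        rw [mnorm_aug]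
        refine Real.sqrt_le_sqrt ?_
        have := cross_sq_le A
        have := pow_le_pow_left₀ hA0 hAK2 2
        linarith
      have h0 : 0 ≤ mnorm (aug A (crossCols A)) := Real.sqrt_nonneg _
      have := Real.rpow_le_rpow h0 h1 hp0.le
      rw [hM]
      gcongr
  have hWc : Continuous fun ζ => W (aug A ζ) := hW1.comp (continuous_aug_s6 A)
  have hT : IsCompact {ζ | W (aug A ζ) ≤ ENNReal.ofReal M} := by
    have hbox : IsCompact (Set.univ.pi fun _ : Fin 3 => Set.Icc (-R) R) :=
      isCompact_univ_pi fun _ => isCompact_Icc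
    refine IsCompact.of_isClosed_subset hbox (isClosed_le hWc continuous_const) ?_
    intro ζ hζ i _
    have h := (abs_le_mnorm (aug A ζ) i 2).trans (hbound _ hζ)
    exact abs_le.mp (by simpa [aug] using h)
  obtain ⟨ζ, hζ, hmin⟩ := hT.exists_isMinOn ⟨_, hz⟩ hWc.continuousOn
  have hζ' : W (aug A ζ) ≤ ENNReal.ofReal M := hζ
  refine ⟨ζ, ?_, ?_, le_antisymm (le_iInf fun ξ => ?_) (iInf_le _ ζ)⟩
  · refine le_trans ?_ (hd _ hζ')
    rw [div_le_iff₀ hβ]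
    calc (1:ℝ) = d * (1 / d) := by field_simp
      _ ≤ d * max R (1 / d) := by gcongr; exact le_max_right _ _
  · exact ((vnorm_le_aug A ζ).trans (hbound _ hζ')).trans (le_max_left _ _)
  · by_cases h : W (aug A ξ) ≤ ENNReal.ofReal M
    · exact hmin h
    · exact hζ'.trans (not_le.mp h).le
end
end

section
/- Let 1 < p < ∞ and let W : M^{3×3} → [0,+∞] satisfy hypotheses (H1)–(H5), and let W₀(A) := inf_{ζ∈ℝ³} W(A|ζ). For α, K > 0 there exist β₁ = β₁(α,K) > 0 and β₂ = β₂(α,K) > 0 such that for every A ∈ M^{3×2} with |A¹ ∧ A²| ≥ α and |A| ≤ K, and every ζ ∈ ℝ³ with W(A|ζ) ≤ W₀(A) + 1, one has |ζ| ≤ β₁ and det(A|ζ) ≥ 1/β₂. -/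
open Filter MeasureTheory Set
open scoped ENNReal

noncomputable section

theorem aux_sq_mnorm {k l : ℕ} (A : Matrix (Fin k) (Fin l) ℝ) :
    mnorm A ^ 2 = ∑ i, ∑ j, A i j ^ 2 :=
  Real.sq_sqrt (Finset.sum_nonneg fun _ _ => Finset.sum_nonneg fun _ _ => sq_nonneg _)

theorem aux_sq_vnorm {k : ℕ} (x : Fin k → ℝ) : vnorm x ^ 2 = ∑ i, x i ^ 2 :=
  Real.sq_sqrt (Finset.sum_nonneg fun _ _ => sq_nonneg _)

theorem aux_mnorm_aug (A : Matrix (Fin 3) (Fin 2) ℝ) (ζ : Fin 3 → ℝ) :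
    mnorm (aug A ζ) ^ 2 = mnorm A ^ 2 + vnorm ζ ^ 2 := by
  rw [aux_sq_mnorm, aux_sq_mnorm, aux_sq_vnorm]
  simp [Fin.sum_univ_three, aug]
  ring

theorem aux_det (A : Matrix (Fin 3) (Fin 2) ℝ) :
    (aug A (crossCols A)).det = vnorm (crossCols A) ^ 2 := by
  rw [aux_sq_vnorm]
  simp [Matrix.det_fin_three, Fin.sum_univ_three, aug, crossCols, cross3]
  ring

theorem aux_cross (A : Matrix (Fin 3) (Fin 2) ℝ) :
    vnorm (crossCols A) ^ 2 ≤ (mnorm A ^ 2) ^ 2 := by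
  rw [aux_sq_vnorm, aux_sq_mnorm]
  simp only [Fin.sum_univ_three, Fin.sum_univ_two, crossCols, cross3, Matrix.cons_val_zero,
    Matrix.cons_val_one, Matrix.cons_val]
  generalize A 0 0 = a
  generalize A 1 0 = b
  generalize A 2 0 = c
  generalize A 0 1 = d
  generalize A 1 1 = e
  generalize A 2 1 = f
  have h : (b * f - c * e) ^ 2 + (c * d - a * f) ^ 2 + (a * e - b * d) ^ 2
      = (a^2+b^2+c^2) * (d^2+e^2+f^2) - (a*d+b*e+c*f)^2 := by ring
  have h2 : 0 ≤ a^2+b^2+c^2 := by positivity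
  have h3 : 0 ≤ d^2+e^2+f^2 := by positivity
  nlinarith [sq_nonneg (a*d+b*e+c*f), mul_nonneg h2 h3, sq_nonneg (a^2+b^2+c^2), sq_nonneg (d^2+e^2+f^2)]

theorem aux_mnorm_nonneg {k l : ℕ} (A : Matrix (Fin k) (Fin l) ℝ) : 0 ≤ mnorm A :=
  Real.sqrt_nonneg _

theorem aux_mnorm_cont : Continuous (fun F : Matrix (Fin 3) (Fin 3) ℝ => mnorm F) := by
  unfold mnorm
  fun_prop

theorem aux_compact (B : ℝ) : IsCompact {F : Matrix (Fin 3) (Fin 3) ℝ | mnorm F ≤ B} := by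
  have h1 : IsCompact (Set.pi Set.univ fun _ : Fin 3 => Set.pi Set.univ fun _ : Fin 3 =>
      Set.Icc (-B) B) := isCompact_univ_pi fun _ => isCompact_univ_pi fun _ => isCompact_Icc
  refine IsCompact.of_isClosed_subset (s := (Set.pi Set.univ fun _ : Fin 3 =>
    Set.pi Set.univ fun _ : Fin 3 => Set.Icc (-B) B : Set (Matrix (Fin 3) (Fin 3) ℝ))) h1
    (isClosed_le aux_mnorm_cont continuous_const) ?_
  intro F hF i _ j _
  have h2 : F i j ^ 2 ≤ mnorm F ^ 2 := by
    refine le_trans ?_ (aux_sq_mnorm (k := 3) (l := 3) F).ge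
    refine le_trans ?_ (Finset.single_le_sum (f := fun i => ∑ j, F i j ^ 2)
      (fun _ _ => Finset.sum_nonneg fun _ _ => sq_nonneg _) (Finset.mem_univ i))
    exact Finset.single_le_sum (f := fun j => F i j ^ 2)
      (fun _ _ => sq_nonneg _) (Finset.mem_univ j)
  have h3 := abs_le_of_sq_le_sq' h2 (aux_mnorm_nonneg F)
  have hF' : mnorm F ≤ B := hF
  exact ⟨by linarith [h3.1], by linarith [h3.2]⟩

/-- uniform bounds on almost-minimizers ζ of W(A|·) for A in Λ(α,K). -/
theorem stmt7
    (p C₁ : ℝ) (hp : 1 < p) (W : Matrix (Fin 3) (Fin 3) ℝ → ℝ≥0∞)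
    -- (H1) continuity as an extended-valued function
    (hW1 : Continuous W)
    -- (H2) frame indifference
    (hW2 : ∀ (F R : Matrix (Fin 3) (Fin 3) ℝ), R.transpose * R = 1 → R.det = 1 →
      W (R * F) = W F)
    -- (H3)
    (hW3fin : ∀ F : Matrix (Fin 3) (Fin 3) ℝ, 0 < F.det → W F ≠ ⊤)
    (hW3inf : ∀ F : Matrix (Fin 3) (Fin 3) ℝ, F.det ≤ 0 → W F = ⊤)
    -- (H4) p-coercivity
    (hC₁ : 0 < C₁)
    (hW4 : ∀ F, ENNReal.ofReal (C₁ * mnorm F ^ p - 1 / C₁) ≤ W F)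
    -- (H5) weak p-growth where the determinant is bounded away from 0
    (hW5 : ∀ δ : ℝ, 0 < δ → ∃ c : ℝ, 0 < c ∧ ∀ F, δ ≤ F.det →
      W F ≤ ENNReal.ofReal (c * (1 + mnorm F ^ p)))
    (α K : ℝ) (hα : 0 < α) (hK : 0 < K) :
    ∃ β₁ > (0:ℝ), ∃ β₂ > (0:ℝ), ∀ (A : Matrix (Fin 3) (Fin 2) ℝ) (ζ : Fin 3 → ℝ),
      α ≤ vnorm (crossCols A) → mnorm A ≤ K →
      W (aug A ζ) ≤ W0fun W A + 1 →
      vnorm ζ ≤ β₁ ∧ 1 / β₂ ≤ (aug A ζ).det := by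
  obtain ⟨c, hc, hW5'⟩ := hW5 (α ^ 2) (by positivity)
  have hp0 : 0 < p := by linarith
  set D : ℝ := Real.sqrt (K ^ 2 + (K ^ 2) ^ 2) with hD
  have hD0 : 0 ≤ D := Real.sqrt_nonneg _
  set M : ℝ := c * (1 + D ^ p) + 1 with hM
  have hM0 : 0 < M := by positivity
  set T : ℝ := (M + 1 / C₁) / C₁ with hT
  have hT0 : 0 < T := by positivity
  set B : ℝ := T ^ (1 / p) with hB
  have hB0 : 0 < B := by positivity
  have key : ∀ (A : Matrix (Fin 3) (Fin 2) ℝ) (ζ : Fin 3 → ℝ),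
      α ≤ vnorm (crossCols A) → mnorm A ≤ K → W (aug A ζ) ≤ W0fun W A + 1 →
      W (aug A ζ) ≤ ENNReal.ofReal M ∧ mnorm (aug A ζ) ≤ B := by
    intro A ζ h1 h2 h3
    have hAK : mnorm A ^ 2 ≤ K ^ 2 := pow_le_pow_left₀ (aux_mnorm_nonneg A) h2 2
    have e1 : mnorm (aug A (crossCols A)) ≤ D := by
      apply Real.le_sqrt_of_sq_le
      rw [aux_mnorm_aug]
      have := aux_cross A
      have h5 : (mnorm A ^ 2) ^ 2 ≤ (K ^ 2) ^ 2 := pow_le_pow_left₀ (sq_nonneg _) hAK 2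
      linarith
    have e2 : W0fun W A ≤ ENNReal.ofReal (c * (1 + D ^ p)) := by
      refine (iInf_le _ (crossCols A)).trans ((hW5' _ ?_).trans (ENNReal.ofReal_le_ofReal ?_))
      · rw [aux_det]
        exact pow_le_pow_left₀ hα.le h1 2
      · have := Real.rpow_le_rpow (aux_mnorm_nonneg _) e1 hp0.le
        gcongr
    have e3 : W (aug A ζ) ≤ ENNReal.ofReal M := by
      refine h3.trans ?_
      rw [hM, ENNReal.ofReal_add (by positivity) zero_le_one, ENNReal.ofReal_one]
      gcongr
    refine ⟨e3, ?_⟩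
    have e4 := (hW4 (aug A ζ)).trans e3
    rw [ENNReal.ofReal_le_ofReal_iff hM0.le] at e4
    have e5 : mnorm (aug A ζ) ^ p ≤ T := by
      rw [hT, le_div_iff₀ hC₁]
      linarith
    have e6 := Real.rpow_le_rpow (Real.rpow_nonneg (aux_mnorm_nonneg _) p) e5
      (by positivity : 0 ≤ 1 / p)
    rwa [← Real.rpow_mul (aux_mnorm_nonneg _), mul_one_div_cancel hp0.ne', Real.rpow_one] at e6
  have hdet : ∃ m > (0:ℝ), ∀ F : Matrix (Fin 3) (Fin 3) ℝ, mnorm F ≤ B →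
      W F ≤ ENNReal.ofReal M → m ≤ F.det := by
    have hS : IsCompact ({F : Matrix (Fin 3) (Fin 3) ℝ | mnorm F ≤ B} ∩
        {F | W F ≤ ENNReal.ofReal M}) :=
      (aux_compact B).inter_right (isClosed_le hW1 continuous_const)
    rcases Set.eq_empty_or_nonempty ({F : Matrix (Fin 3) (Fin 3) ℝ | mnorm F ≤ B} ∩
        {F | W F ≤ ENNReal.ofReal M}) with he | hne
    · refine ⟨1, one_pos, fun F h1 h2 => ?_⟩
      exact absurd (he ▸ (⟨h1, h2⟩ : F ∈ ({F : Matrix (Fin 3) (Fin 3) ℝ | mnorm F ≤ B} ∩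
        {F | W F ≤ ENNReal.ofReal M}))) (Set.notMem_empty F)
    · obtain ⟨F0, hF0, hmin⟩ := hS.exists_isMinOn hne
        (f := fun F => F.det) (continuous_id.matrix_det.continuousOn)
      refine ⟨F0.det, ?_, fun F h1 h2 => hmin ⟨h1, h2⟩⟩
      by_contra hneg
      have h4 := hW3inf F0 (not_lt.mp hneg)
      have h5 : W F0 ≤ ENNReal.ofReal M := hF0.2
      rw [h4] at h5
      exact ENNReal.ofReal_ne_top (top_le_iff.mp h5)
  obtain ⟨m, hm, hmdet⟩ := hdet
  refine ⟨B, hB0, 1 / m, by positivity, fun A ζ h1 h2 h3 => ?_⟩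
  obtain ⟨k1, k2⟩ := key A ζ h1 h2 h3
  refine ⟨le_trans ?_ k2, ?_⟩
  · refine abs_le_of_sq_le_sq' ?_ (aux_mnorm_nonneg _) |>.2
    rw [aux_mnorm_aug]
    nlinarith [sq_nonneg (mnorm A)]
  · rw [one_div_one_div]
    exact hmdet _ k2 k1
end
end

section
/- Let 1 < p < ∞ and let W₀ : M^{3×2} → [0,+∞] be continuous as an extended-valued function and p-coercive, with W₀(A) = +∞ if and only if A¹ ∧ A² = 0, and such that for every δ > 0 there exists c_δ > 0 with W₀(A) ≤ c_δ(1 + |A|^p) whenever |A¹ ∧ A²| ≥ δ. Then the rank-one convex envelope RW₀ is finite valued, continuous and p-coercive, and there exists C > 0 such that RW₀(A) ≤ C(1 + |A|^p) for every A ∈ M^{3×2}. -/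
open Filter MeasureTheory Set
open scoped ENNReal

noncomputable section

/-- Rank-one convexity for extended-valued functions on 3×2 matrices. -/
def RankOneConvexENN (f : Matrix (Fin 3) (Fin 2) ℝ → ℝ≥0∞) : Prop :=
  ∀ (ξ ξ' : Matrix (Fin 3) (Fin 2) ℝ) (lam : ℝ), lam ∈ Set.Ioo (0:ℝ) 1 →
    (ξ - ξ').rank = 1 →
    f (lam • ξ + (1 - lam) • ξ') ≤ ENNReal.ofReal lam * f ξ + ENNReal.ofReal (1 - lam) * f ξ'

/-- The rank-one convex envelope: the greatest rank-one convex function below `f`,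
realized as the pointwise supremum of all rank-one convex functions below `f`. -/
noncomputable def rankOneEnv (f : Matrix (Fin 3) (Fin 2) ℝ → ℝ≥0∞) :
    Matrix (Fin 3) (Fin 2) ℝ → ℝ≥0∞ :=
  fun A => ⨆ g ∈ {g : Matrix (Fin 3) (Fin 2) ℝ → ℝ≥0∞ |
    RankOneConvexENN g ∧ ∀ B, g B ≤ f B}, g A

lemma mnorm_eq_norm (A : Matrix (Fin 3) (Fin 2) ℝ) :
    mnorm A = ‖(WithLp.toLp 2 (fun ij : Fin 3 × Fin 2 => A ij.1 ij.2) :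
      EuclideanSpace ℝ (Fin 3 × Fin 2))‖ := by
  rw [EuclideanSpace.norm_eq, mnorm, Fintype.sum_prod_type]
  simp

lemma mnorm_add_le (A B : Matrix (Fin 3) (Fin 2) ℝ) : mnorm (A + B) ≤ mnorm A + mnorm B := by
  simp only [mnorm_eq_norm]
  exact norm_add_le (WithLp.toLp 2 (fun ij : Fin 3 × Fin 2 => A ij.1 ij.2) :
      EuclideanSpace ℝ (Fin 3 × Fin 2)) (WithLp.toLp 2 (fun ij : Fin 3 × Fin 2 => B ij.1 ij.2))

lemma mnorm_smul (c : ℝ) (A : Matrix (Fin 3) (Fin 2) ℝ) : mnorm (c • A) = |c| * mnorm A := by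
  simp only [mnorm_eq_norm]
  exact norm_smul c (WithLp.toLp 2 (fun ij : Fin 3 × Fin 2 => A ij.1 ij.2) :
      EuclideanSpace ℝ (Fin 3 × Fin 2))

lemma mnorm_nonneg' (A : Matrix (Fin 3) (Fin 2) ℝ) : 0 ≤ mnorm A := Real.sqrt_nonneg _

lemma roc_vec {f : Matrix (Fin 3) (Fin 2) ℝ → ℝ≥0∞} (hf : RankOneConvexENN f)
    (ξ ξ' : Matrix (Fin 3) (Fin 2) ℝ) (u : Fin 3 → ℝ) (w : Fin 2 → ℝ)
    (h : ξ - ξ' = Matrix.vecMulVec u w) (lam : ℝ) (hl : lam ∈ Set.Ioo (0:ℝ) 1) :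
    f (lam • ξ + (1 - lam) • ξ') ≤
      ENNReal.ofReal lam * f ξ + ENNReal.ofReal (1 - lam) * f ξ' := by
  by_cases h0 : ξ - ξ' = 0
  · have : ξ = ξ' := sub_eq_zero.mp h0
    subst this
    rw [← add_smul, ← add_mul, ← ENNReal.ofReal_add hl.1.le (by linarith [hl.2])]
    simp
  · apply hf ξ ξ' lam hl
    have h1 : (ξ - ξ').rank ≤ 1 := by rw [h]; exact Matrix.rank_vecMulVec_le u w
    have h2 : (ξ - ξ').rank ≠ 0 := by
      intro h3
      rw [Matrix.rank, Submodule.finrank_eq_zero, LinearMap.range_eq_bot] at h3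
      apply h0
      ext i j
      have h4 := congrFun (LinearMap.congr_fun h3 (Pi.single j 1)) i
      rw [Matrix.mulVecLin_apply, Matrix.mulVec_single_one] at h4
      exact h4
    omega

lemma roc_env (f : Matrix (Fin 3) (Fin 2) ℝ → ℝ≥0∞) : RankOneConvexENN (rankOneEnv f) := by
  intro ξ ξ' lam hl hr
  unfold rankOneEnv
  refine iSup₂_le fun g hg => ?_
  refine (hg.1 ξ ξ' lam hl hr).trans ?_
  gcongr
  · exact le_iSup₂ (f := fun (g : Matrix (Fin 3) (Fin 2) ℝ → ℝ≥0∞) (_ : g ∈ {g : Matrix (Fin 3) (Fin 2) ℝ → ℝ≥0∞ |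
    RankOneConvexENN g ∧ ∀ B, g B ≤ f B}) => g ξ) g hg
  · exact le_iSup₂ (f := fun (g : Matrix (Fin 3) (Fin 2) ℝ → ℝ≥0∞) (_ : g ∈ {g : Matrix (Fin 3) (Fin 2) ℝ → ℝ≥0∞ |
    RankOneConvexENN g ∧ ∀ B, g B ≤ f B}) => g ξ') g hg

lemma env_le (f : Matrix (Fin 3) (Fin 2) ℝ → ℝ≥0∞) (A) : rankOneEnv f A ≤ f A :=
  iSup₂_le fun _ hg => hg.2 A

lemma le_env (f g : Matrix (Fin 3) (Fin 2) ℝ → ℝ≥0∞) (h1 : RankOneConvexENN g)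
    (h2 : ∀ B, g B ≤ f B) (A) : g A ≤ rankOneEnv f A :=
  le_iSup₂ (f := fun (g : Matrix (Fin 3) (Fin 2) ℝ → ℝ≥0∞) (_ : g ∈ {g : Matrix (Fin 3) (Fin 2) ℝ → ℝ≥0∞ |
    RankOneConvexENN g ∧ ∀ B, g B ≤ f B}) => g A) g ⟨h1, h2⟩

lemma roc_coer (p C : ℝ) (hp : 1 < p) (hC : 0 < C) :
    RankOneConvexENN (fun A => ENNReal.ofReal (C * mnorm A ^ p - 1 / C)) := by
  intro ξ ξ' lam hl _
  have h1 : 0 ≤ 1 - lam := by linarith [hl.2]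
  rw [← ENNReal.ofReal_mul hl.1.le, ← ENNReal.ofReal_mul h1]
  refine le_trans (ENNReal.ofReal_le_ofReal ?_) ENNReal.ofReal_add_le
  have hm : mnorm (lam • ξ + (1 - lam) • ξ') ≤ lam * mnorm ξ + (1 - lam) * mnorm ξ' := by
    refine (mnorm_add_le _ _).trans ?_
    rw [mnorm_smul, mnorm_smul, abs_of_pos hl.1, abs_of_nonneg h1]
  have h2 : mnorm (lam • ξ + (1 - lam) • ξ') ^ p ≤ lam * mnorm ξ ^ p + (1 - lam) * mnorm ξ' ^ p := by
    refine (Real.rpow_le_rpow (mnorm_nonneg' _) hm (by linarith)).trans ?_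
    have := (convexOn_rpow hp.le).2 (mnorm_nonneg' ξ) (mnorm_nonneg' ξ') hl.1.le h1 (by ring)
    simpa using this
  have := mul_le_mul_of_nonneg_left h2 hC.le
  linarith

lemma roc_half {f : Matrix (Fin 3) (Fin 2) ℝ → ℝ≥0∞} (hf : RankOneConvexENN f)
    (A : Matrix (Fin 3) (Fin 2) ℝ) (u : Fin 3 → ℝ) (w : Fin 2 → ℝ) (K : ℝ≥0∞)
    (h1 : f (A + Matrix.vecMulVec u w) ≤ K) (h2 : f (A - Matrix.vecMulVec u w) ≤ K) : f A ≤ K := by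
  have := roc_vec hf (A + Matrix.vecMulVec u w) (A - Matrix.vecMulVec u w) ((2:ℝ) • u) w
    (by rw [Matrix.smul_vecMulVec, two_smul]; abel) (1/2) (by norm_num)
  have e : ((1/2:ℝ) • (A + Matrix.vecMulVec u w) + (1 - 1/2 : ℝ) • (A - Matrix.vecMulVec u w)) = A := by
    ext i j; simp; ring
  rw [e] at this
  refine this.trans ?_
  calc _ ≤ ENNReal.ofReal (1/2) * K + ENNReal.ofReal (1 - 1/2) * K := by gcongr
    _ = K := by
      rw [← add_mul, ← ENNReal.ofReal_add (by norm_num) (by norm_num)]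
      norm_num

lemma exists_perp (a b : Fin 3 → ℝ) : ∃ v : Fin 3 → ℝ, v 0 ^ 2 + v 1 ^ 2 + v 2 ^ 2 = 1 ∧
    a 0 * v 0 + a 1 * v 1 + a 2 * v 2 = 0 ∧ b 0 * v 0 + b 1 * v 1 + b 2 * v 2 = 0 := by
  obtain ⟨v, hv, h⟩ := (Matrix.exists_mulVec_eq_zero_iff (M := Matrix.of ![a, b, b])).mpr
    (Matrix.det_zero_of_row_eq (i := 1) (j := 2) (by decide) rfl)
  have ha := congrFun h 0
  have hb := congrFun h 1
  simp [Matrix.mulVec, dotProduct, Fin.sum_univ_three] at ha hb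
  have hs : 0 < v 0 ^ 2 + v 1 ^ 2 + v 2 ^ 2 := by
    by_contra hn
    apply hv
    ext i
    fin_cases i <;> simp <;> nlinarith [sq_nonneg (v 0), sq_nonneg (v 1), sq_nonneg (v 2)]
  set s := √(v 0 ^ 2 + v 1 ^ 2 + v 2 ^ 2) with hsdef
  have hs2 : s ^ 2 = v 0 ^ 2 + v 1 ^ 2 + v 2 ^ 2 := Real.sq_sqrt hs.le
  have hs0 : 0 < s := Real.sqrt_pos.mpr hs
  refine ⟨fun i => v i / s, ?_, ?_, ?_⟩
  · field_simp; linarith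
  · field_simp; linarith
  · field_simp; linarith

lemma mnorm_pert (v : Fin 3 → ℝ) (hv : v 0 ^ 2 + v 1 ^ 2 + v 2 ^ 2 = 1) (w : Fin 2 → ℝ)
    (hw : w 0 ^ 2 + w 1 ^ 2 = 1) : mnorm (Matrix.vecMulVec v w) = 1 := by
  unfold mnorm
  rw [Real.sqrt_eq_one]
  simp [Fin.sum_univ_three, Fin.sum_univ_two, Matrix.vecMulVec_apply]
  linear_combination (w 0 ^ 2 + w 1 ^ 2) * hv + hw

lemma cross_ge (A : Matrix (Fin 3) (Fin 2) ℝ) (v : Fin 3 → ℝ)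
    (hv : v 0 ^ 2 + v 1 ^ 2 + v 2 ^ 2 = 1)
    (ha : A 0 0 * v 0 + A 1 0 * v 1 + A 2 0 * v 2 = 0)
    (hb : A 0 1 * v 0 + A 1 1 * v 1 + A 2 1 * v 2 = 0)
    (h1 : 1 ≤ A 0 1 ^ 2 + A 1 1 ^ 2 + A 2 1 ^ 2) :
    1 ≤ vnorm (crossCols (A + Matrix.vecMulVec v ![1, 0])) := by
  unfold vnorm
  rw [Real.one_le_sqrt]
  simp only [crossCols, cross3, Fin.sum_univ_three, Matrix.add_apply, Matrix.vecMulVec_apply,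
    Matrix.cons_val]
  generalize A 0 0 = a0 at *
  generalize A 1 0 = a1 at *
  generalize A 2 0 = a2 at *
  generalize A 0 1 = b0 at *
  generalize A 1 1 = b1 at *
  generalize A 2 1 = b2 at *
  generalize v 0 = v0 at *
  generalize v 1 = v1 at *
  generalize v 2 = v2 at *
  have key : ((a1 + v1 * 1) * (b2 + v2 * 0) - (a2 + v2 * 1) * (b1 + v1 * 0)) ^ 2 +
      ((a2 + v2 * 1) * (b0 + v0 * 0) - (a0 + v0 * 1) * (b2 + v2 * 0)) ^ 2 +
      ((a0 + v0 * 1) * (b1 + v1 * 0) - (a1 + v1 * 1) * (b0 + v0 * 0)) ^ 2 =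
      (a1 * b2 - a2 * b1) ^ 2 + (a2 * b0 - a0 * b2) ^ 2 + (a0 * b1 - a1 * b0) ^ 2 +
      (b0 ^ 2 + b1 ^ 2 + b2 ^ 2) := by
    linear_combination (b0 ^ 2 + b1 ^ 2 + b2 ^ 2) * hv + 2 * (b0 ^ 2 + b1 ^ 2 + b2 ^ 2) * ha
      - (2 * (a0 * b0 + a1 * b1 + a2 * b2) + (b0 * v0 + b1 * v1 + b2 * v2)) * hb
  nlinarith [sq_nonneg (a1 * b2 - a2 * b1), sq_nonneg (a2 * b0 - a0 * b2),
    sq_nonneg (a0 * b1 - a1 * b0)]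

lemma env_bound {p c : ℝ} (hp : 1 < p) (hc : 0 < c)
    {f : Matrix (Fin 3) (Fin 2) ℝ → ℝ≥0∞} (hf : RankOneConvexENN f)
    (h : ∀ A, 1 ≤ vnorm (crossCols A) → f A ≤ ENNReal.ofReal (c * (1 + mnorm A ^ p)))
    (A : Matrix (Fin 3) (Fin 2) ℝ) :
    f A ≤ ENNReal.ofReal (c * (1 + (mnorm A + 2) ^ p)) := by
  have hneg : ∀ (u : Fin 3 → ℝ) (w : Fin 2 → ℝ) (B : Matrix (Fin 3) (Fin 2) ℝ),
      B - Matrix.vecMulVec u w = B + Matrix.vecMulVec (-u) w := by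
    intro u w B
    rw [Matrix.neg_vecMulVec, sub_eq_add_neg]
  have s1 : ∀ B : Matrix (Fin 3) (Fin 2) ℝ, 1 ≤ B 0 1 ^ 2 + B 1 1 ^ 2 + B 2 1 ^ 2 →
      mnorm B ≤ mnorm A + 1 → f B ≤ ENNReal.ofReal (c * (1 + (mnorm A + 2) ^ p)) := by
    intro B hB hBA
    obtain ⟨v, hv, ha, hb⟩ := exists_perp (fun i => B i 0) (fun i => B i 1)
    have fin : ∀ v' : Fin 3 → ℝ, v' 0 ^ 2 + v' 1 ^ 2 + v' 2 ^ 2 = 1 →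
        B 0 0 * v' 0 + B 1 0 * v' 1 + B 2 0 * v' 2 = 0 →
        B 0 1 * v' 0 + B 1 1 * v' 1 + B 2 1 * v' 2 = 0 →
        f (B + Matrix.vecMulVec v' ![1, 0]) ≤ ENNReal.ofReal (c * (1 + (mnorm A + 2) ^ p)) := by
      intro v' hv' ha' hb'
      refine (h _ (cross_ge B v' hv' ha' hb' hB)).trans (ENNReal.ofReal_le_ofReal ?_)
      have : mnorm (B + Matrix.vecMulVec v' ![1, 0]) ≤ mnorm A + 2 := by
        have := mnorm_add_le B (Matrix.vecMulVec v' ![1, 0])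
        rw [mnorm_pert v' hv' _ (by simp)] at this
        linarith
      have := Real.rpow_le_rpow (mnorm_nonneg' _) this (by linarith : 0 ≤ p)
      gcongr
    refine roc_half hf B v ![1, 0] _ (fin v hv ha hb) ?_
    rw [hneg]
    refine fin (-v) ?_ ?_ ?_ <;> simp only [Pi.neg_apply] <;> linarith
  obtain ⟨v, hv, ha, -⟩ := exists_perp (fun i => A i 1) (fun i => A i 1)
  have fin : ∀ v' : Fin 3 → ℝ, v' 0 ^ 2 + v' 1 ^ 2 + v' 2 ^ 2 = 1 →
      A 0 1 * v' 0 + A 1 1 * v' 1 + A 2 1 * v' 2 = 0 →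
      f (A + Matrix.vecMulVec v' ![0, 1]) ≤ ENNReal.ofReal (c * (1 + (mnorm A + 2) ^ p)) := by
    intro v' hv' ha'
    apply s1
    · simp [Matrix.vecMulVec_apply]
      nlinarith [sq_nonneg (A 0 1), sq_nonneg (A 1 1), sq_nonneg (A 2 1)]
    · have := mnorm_add_le A (Matrix.vecMulVec v' ![0, 1])
      rwa [mnorm_pert v' hv' _ (by simp)] at this
  refine roc_half hf A v ![0, 1] _ (fin v hv ha) ?_
  rw [hneg]
  refine fin (-v) ?_ ?_ <;> simp only [Pi.neg_apply] <;> linarith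

lemma step_lip {F : Matrix (Fin 3) (Fin 2) ℝ → ℝ} (h0 : ∀ A, 0 ≤ F A)
    (hF : ∀ (ξ ξ' : Matrix (Fin 3) (Fin 2) ℝ) (u : Fin 3 → ℝ) (w : Fin 2 → ℝ),
      ξ - ξ' = Matrix.vecMulVec u w → ∀ lam ∈ Set.Ioo (0:ℝ) 1,
      F (lam • ξ + (1 - lam) • ξ') ≤ lam * F ξ + (1 - lam) * F ξ')
    (r M : ℝ) (hM : ∀ A, mnorm A ≤ r + 1 → F A ≤ M)
    (X : Matrix (Fin 3) (Fin 2) ℝ) (hX : mnorm X ≤ r) (u : Fin 3 → ℝ) (w : Fin 2 → ℝ)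
    (hD : mnorm (Matrix.vecMulVec u w) < 1) :
    |F (X + Matrix.vecMulVec u w) - F X| ≤ M * mnorm (Matrix.vecMulVec u w) := by
  set t := mnorm (Matrix.vecMulVec u w) with ht
  rcases (mnorm_nonneg' (Matrix.vecMulVec u w)).eq_or_lt with h | h
  · have hz : Matrix.vecMulVec u w = 0 := by
      have h' := h.symm
      rw [mnorm_eq_norm, norm_eq_zero] at h'
      ext i j
      exact congrArg (fun x : EuclideanSpace ℝ (Fin 3 × Fin 2) => x (i, j)) h'
    rw [ht, ← h, hz]
    simp
  rw [← ht] at h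
  have eD : Matrix.vecMulVec (t⁻¹ • u) w = t⁻¹ • Matrix.vecMulVec u w := Matrix.smul_vecMulVec _ _ _
  have nD : mnorm (Matrix.vecMulVec (t⁻¹ • u) w) = 1 := by
    rw [eD, mnorm_smul, ← ht, abs_of_pos (by positivity), inv_mul_cancel₀ h.ne']
  have nD' : mnorm (Matrix.vecMulVec (-(t⁻¹ • u)) w) = 1 := by
    rw [← nD, Matrix.neg_vecMulVec, ← neg_one_smul ℝ, mnorm_smul]; simp
  have b1 : F (X + Matrix.vecMulVec (t⁻¹ • u) w) ≤ M := hM _ (by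
    have := mnorm_add_le X (Matrix.vecMulVec (t⁻¹ • u) w); linarith)
  have b2 : F (X + Matrix.vecMulVec (-(t⁻¹ • u)) w) ≤ M := hM _ (by
    have := mnorm_add_le X (Matrix.vecMulVec (-(t⁻¹ • u)) w); linarith)
  have c1 := hF (X + Matrix.vecMulVec (t⁻¹ • u) w) X (t⁻¹ • u) w (by abel) t ⟨h, hD⟩
  have e1 : t • (X + Matrix.vecMulVec (t⁻¹ • u) w) + (1 - t) • X = X + Matrix.vecMulVec u w := by
    rw [eD]; ext i j; simp; field_simp; ring
  rw [e1] at c1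
  have c2 := hF (X + Matrix.vecMulVec u w) (X + Matrix.vecMulVec (-(t⁻¹ • u)) w) ((1 + t⁻¹) • u) w
    (by ext i j; simp [Matrix.vecMulVec_apply]; ring) (1 / (1 + t))
    ⟨by positivity, by rw [div_lt_one (by positivity)]; linarith⟩
  have e2 : (1 / (1 + t)) • (X + Matrix.vecMulVec u w) +
      (1 - 1 / (1 + t)) • (X + Matrix.vecMulVec (-(t⁻¹ • u)) w) = X := by
    ext i j; simp [Matrix.vecMulVec_apply]; field_simp; ring
  rw [e2] at c2
  have c3 : (1 + t) * F X ≤ F (X + Matrix.vecMulVec u w) +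
      t * F (X + Matrix.vecMulVec (-(t⁻¹ • u)) w) := by
    have := mul_le_mul_of_nonneg_left c2 (by positivity : 0 ≤ 1 + t)
    refine this.trans (le_of_eq ?_)
    field_simp; ring
  have c4 := mul_le_mul_of_nonneg_left b1 h.le
  have c5 := mul_le_mul_of_nonneg_left b2 h.le
  have c6 := mul_nonneg h.le (h0 X)
  rw [abs_le]
  constructor <;> nlinarith

lemma cont_of {F : Matrix (Fin 3) (Fin 2) ℝ → ℝ} (h0 : ∀ A, 0 ≤ F A)
    (hF : ∀ (ξ ξ' : Matrix (Fin 3) (Fin 2) ℝ) (u : Fin 3 → ℝ) (w : Fin 2 → ℝ),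
      ξ - ξ' = Matrix.vecMulVec u w → ∀ lam ∈ Set.Ioo (0:ℝ) 1,
      F (lam • ξ + (1 - lam) • ξ') ≤ lam * F ξ + (1 - lam) * F ξ')
    (hM : ∀ r : ℝ, ∃ M, ∀ A, mnorm A ≤ r → F A ≤ M) : Continuous F := by
  rw [continuous_iff_continuousAt]
  intro X
  obtain ⟨M, hM⟩ := hM (mnorm X + 1 + 1)
  have cm : Continuous (mnorm : Matrix (Fin 3) (Fin 2) ℝ → ℝ) := by
    unfold mnorm; fun_prop
  let P : Fin 2 → Matrix (Fin 3) (Fin 2) ℝ → Matrix (Fin 3) (Fin 2) ℝ := fun k A =>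
    Matrix.vecMulVec (fun i => A i k - X i k) (Pi.single k 1)
  have cP : ∀ k, Continuous (fun A => mnorm (P k A)) := by
    intro k
    refine cm.comp ?_
    refine continuous_matrix fun i j => ?_
    simp only [P, Matrix.vecMulVec_apply]
    fun_prop
  have zP : ∀ k, mnorm (P k X) = 0 := by
    intro k; simp [P, mnorm, Matrix.vecMulVec_apply]
  have tP : ∀ k, Tendsto (fun A => mnorm (P k A)) (nhds X) (nhds 0) := by
    intro k; rw [← zP k]; exact (cP k).tendsto X
  have eP : ∀ A, A = X + P 0 A + P 1 A := by
    intro A; ext i j; fin_cases j <;> simp [P, Matrix.vecMulVec_apply]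
  rw [ContinuousAt, tendsto_iff_dist_tendsto_zero]
  refine squeeze_zero' (g := fun A => M * mnorm (P 0 A) + M * mnorm (P 1 A))
    (Eventually.of_forall fun _ => dist_nonneg) ?_ ?_
  · filter_upwards [(tP 0).eventually (gt_mem_nhds one_pos),
      (tP 1).eventually (gt_mem_nhds one_pos)] with A h1 h2
    have s1 := step_lip h0 hF (mnorm X + 1) M hM X (by linarith) _ _ h1
    have s2 := step_lip h0 hF (mnorm X + 1) M hM (X + P 0 A)
      (by have := mnorm_add_le X (P 0 A); linarith) _ _ h2
    have e : F (X + P 0 A + P 1 A) = F A := by rw [← eP]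
    change |F (X + P 0 A) - F X| ≤ M * mnorm (P 0 A) at s1
    change |F (X + P 0 A + P 1 A) - F (X + P 0 A)| ≤ M * mnorm (P 1 A) at s2
    rw [e] at s2
    rw [Real.dist_eq]
    have := abs_sub_le (F A) (F (X + P 0 A)) (F X)
    linarith
  · have := ((tP 0).const_mul M).add ((tP 1).const_mul M)
    simpa using this

/-- the rank-one convex envelope RW₀ is finite valued, continuous,
p-coercive and has p-growth from above. -/
theorem stmt12
    (p C₁ : ℝ) (hp : 1 < p) (hC₁ : 0 < C₁)
    (W₀ : Matrix (Fin 3) (Fin 2) ℝ → ℝ≥0∞)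
    -- W₀ continuous as an extended-valued function
    (hW₀cont : Continuous W₀)
    -- W₀ p-coercive
    (hW₀coer : ∀ A, ENNReal.ofReal (C₁ * mnorm A ^ p - 1 / C₁) ≤ W₀ A)
    -- W₀(A) = +∞ iff A¹ ∧ A² = 0
    (hW₀top : ∀ A, W₀ A = ⊤ ↔ crossCols A = 0)
    -- p-growth where |A¹ ∧ A²| is bounded away from 0
    (hW₀grow : ∀ δ : ℝ, 0 < δ → ∃ c : ℝ, 0 < c ∧ ∀ A, δ ≤ vnorm (crossCols A) →
      W₀ A ≤ ENNReal.ofReal (c * (1 + mnorm A ^ p)))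
    :
    (∀ A, rankOneEnv W₀ A ≠ ⊤) ∧
    Continuous (rankOneEnv W₀) ∧
    (∃ C : ℝ, 0 < C ∧ ∀ A, ENNReal.ofReal (C * mnorm A ^ p - 1 / C) ≤ rankOneEnv W₀ A) ∧
    (∃ C : ℝ, 0 < C ∧ ∀ A, rankOneEnv W₀ A ≤ ENNReal.ofReal (C * (1 + mnorm A ^ p))) := by
  obtain ⟨c, hc, hg⟩ := hW₀grow 1 one_pos
  have hR := roc_env W₀
  have hb : ∀ A, rankOneEnv W₀ A ≤ ENNReal.ofReal (c * (1 + (mnorm A + 2) ^ p)) :=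
    env_bound hp hc hR fun A hA => (env_le W₀ A).trans (hg A hA)
  have hfin : ∀ A, rankOneEnv W₀ A ≠ ⊤ := fun A => ne_top_of_le_ne_top ENNReal.ofReal_ne_top (hb A)
  refine ⟨hfin, ?_, ⟨C₁, hC₁, le_env W₀ _ (roc_coer p C₁ hp hC₁) hW₀coer⟩, ?_⟩
  · have hcF : Continuous (fun A => (rankOneEnv W₀ A).toReal) := by
      apply cont_of (fun _ => ENNReal.toReal_nonneg)
      · intro ξ ξ' u w h lam hl
        have h1 : 0 ≤ 1 - lam := by linarith [hl.2]
        have := roc_vec hR ξ ξ' u w h lam hl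
        have := ENNReal.toReal_mono (by finiteness [hfin ξ, hfin ξ']) this
        rwa [ENNReal.toReal_add (by finiteness [hfin ξ]) (by finiteness [hfin ξ']),
          ENNReal.toReal_mul, ENNReal.toReal_mul, ENNReal.toReal_ofReal hl.1.le,
          ENNReal.toReal_ofReal h1] at this
      · intro r
        refine ⟨c * (1 + (r + 2) ^ p), fun A hA => ?_⟩
        have hn := mnorm_nonneg' A
        refine ENNReal.toReal_le_of_le_ofReal ?_ ((hb A).trans (ENNReal.ofReal_le_ofReal ?_))
        · have : 0 ≤ r + 2 := by linarith
          positivity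
        · gcongr
    have := ENNReal.continuous_ofReal.comp hcF
    convert this using 1
    ext A
    simp [ENNReal.ofReal_toReal (hfin A)]
  · refine ⟨c * (1 + 2 ^ p + 2 ^ p * 2 ^ p), by positivity, fun A => (hb A).trans
      (ENNReal.ofReal_le_ofReal ?_)⟩
    have hn := mnorm_nonneg' A
    have h1 : (mnorm A + 2) ^ p ≤ 2 ^ p * mnorm A ^ p + 2 ^ p * 2 ^ p := by
      rcases le_total (mnorm A) 2 with h | h
      · have : (mnorm A + 2) ^ p ≤ (2 * 2) ^ p :=
          Real.rpow_le_rpow (by linarith) (by linarith) (by linarith)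
        rw [Real.mul_rpow (by norm_num) (by norm_num)] at this
        have : 0 ≤ (2:ℝ) ^ p * mnorm A ^ p := by positivity
        linarith
      · have : (mnorm A + 2) ^ p ≤ (2 * mnorm A) ^ p :=
          Real.rpow_le_rpow (by linarith) (by linarith) (by linarith)
        rw [Real.mul_rpow (by norm_num) hn] at this
        have : 0 ≤ (2:ℝ) ^ p * 2 ^ p := by positivity
        linarith
    rw [mul_assoc]
    refine mul_le_mul_of_nonneg_left ?_ hc.le
    have h2 : 0 ≤ mnorm A ^ p := by positivity
    have h3 : 0 ≤ (2:ℝ) ^ p := by positivity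
    have h4 := mul_nonneg (mul_nonneg h3 h3) h2
    nlinarith
end
end
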